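/- arXiv:2412.02070 — 9 statements merged into one kernel-verified Lean document; each statement's English description precedes it below -/
import Mathlib

section
/- Let d ≥ 3 be an integer. Suppose u : ℝ^d → ℝ is radial, continuously differentiable on ℝ^d ∖ {0}, and A := ∫_{ℝ^d} (|∇u(x)|² + |u(x)|²/|x|) dx is finite. Then there exists a constant C depending only on d such that for every x ≠ 0, |u(x)| ≤ C · |x|^{-(2d-3)/4} · A^{1/2}. -/
open MeasureTheory

open Set in
/-- A function with finite weighted energy on `(0, ∞)` is small somewhere arbitrarily far out. -/
lemma exists_gt_sq_lt_of_integrableOn {v : ℝ → ℝ} {n : ℕ} (hn : 1 ≤ n)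
    (hint : IntegrableOn (fun t => t ^ n * (deriv v t ^ 2 + v t ^ 2 / t)) (Ioi 0))
    {r : ℝ} (hr : 0 < r) {ε : ℝ} (hε : 0 < ε) : ∃ s, r < s ∧ v s ^ 2 < ε := by
  by_contra! h
  have hconst : IntegrableOn (fun _ : ℝ => r ^ (n - 1) * ε) (Ioi r) := by
    refine (hint.mono_set (Ioi_subset_Ioi hr.le)).mono' aestronglyMeasurable_const ?_
    filter_upwards [ae_restrict_mem measurableSet_Ioi] with t ht
    have ht' : r < t := ht
    have ht0 : 0 < t := hr.trans ht'
    rw [Real.norm_of_nonneg (by positivity)]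
    calc r ^ (n - 1) * ε ≤ t ^ (n - 1) * v t ^ 2 := by
          gcongr
          exact h t ht'
      _ = t ^ n * (v t ^ 2 / t) := by
          obtain ⟨m, rfl⟩ := Nat.exists_eq_add_of_le' hn
          rw [Nat.add_sub_cancel]
          field_simp
          ring
      _ ≤ _ := by
          gcongr
          nlinarith [sq_nonneg (deriv v t)]
  rw [integrableOn_const_iff] at hconst
  rcases hconst with h0 | h0
  · have : 0 < r ^ (n - 1) * ε := by positivity
    exact this.ne' (by simpa using h0)
  · simp at h0

open Set in
/-- One-dimensional form of the decay estimate: `t ^ (n - 1/2) * v t ^ 2` is bounded by the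
weighted energy of `v`. -/
lemma rpow_mul_sq_le_integral {v : ℝ → ℝ} {n : ℕ} (hn : 1 ≤ n)
    (hv : ContDiffOn ℝ 1 v (Ioi 0))
    (hint : IntegrableOn (fun t => t ^ n * (deriv v t ^ 2 + v t ^ 2 / t)) (Ioi 0))
    {r : ℝ} (hr : 0 < r) :
    r ^ ((n : ℝ) - 1 / 2) * v r ^ 2 ≤
      ∫ t in Ioi 0, t ^ n * (deriv v t ^ 2 + v t ^ 2 / t) := by
  set p : ℝ := (n : ℝ) - 1 / 2 with hp
  have hp0 : 0 ≤ p := by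
    have : (1 : ℝ) ≤ n := by exact_mod_cast hn
    rw [hp]; linarith
  have hrp : 0 < r ^ p := by positivity
  have hdc : ContinuousOn (deriv v) (Ioi 0) :=
    hv.continuousOn_deriv_of_isOpen isOpen_Ioi le_rfl
  refine le_of_forall_pos_le_add fun ε hε => ?_
  obtain ⟨s, hrs, hs⟩ := exists_gt_sq_lt_of_integrableOn hn hint hr (div_pos hε hrp)
  have hsub : uIcc r s ⊆ Ioi 0 := by
    rw [uIcc_of_le hrs.le]
    exact fun t ht => hr.trans_le ht.1
  have hderiv : ∀ t ∈ uIcc r s, HasDerivAt (fun t => v t ^ 2) (2 * v t * deriv v t) t := by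
    intro t ht
    have h1 : DifferentiableAt ℝ v t :=
      (hv.differentiableOn one_ne_zero).differentiableAt (Ioi_mem_nhds (hsub ht))
    simpa using h1.hasDerivAt.fun_pow 2
  have hci : IntervalIntegrable (fun t => 2 * v t * deriv v t) volume r s :=
    (((continuousOn_const.mul hv.continuousOn).mul hdc).mono hsub).intervalIntegrable
  have hftc := intervalIntegral.integral_eq_sub_of_hasDerivAt hderiv hci
  have hsub' : Ioc r s ⊆ Ioi 0 := fun t ht => hr.trans ht.1
  have hbound : -(r ^ p * ∫ t in r..s, 2 * v t * deriv v t) ≤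
      ∫ t in Ioi 0, t ^ n * (deriv v t ^ 2 + v t ^ 2 / t) := by
    rw [intervalIntegral.integral_of_le hrs.le, ← integral_const_mul, ← integral_neg]
    refine le_trans (setIntegral_mono_on ((hci.1.const_mul _).neg)
      (hint.mono_set hsub') measurableSet_Ioc fun t ht => ?_)
      (setIntegral_mono_set hint ?_ hsub'.eventuallyLE)
    · have ht0 : 0 < t := hsub' ht
      have hsq : Real.sqrt t ^ 2 = t := Real.sq_sqrt ht0.le
      have hs0 : 0 < Real.sqrt t := Real.sqrt_pos.2 ht0
      have htp : t ^ p = t ^ n / Real.sqrt t := by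
        rw [hp, Real.rpow_sub ht0, Real.rpow_natCast, Real.sqrt_eq_rpow]
      calc -(r ^ p * (2 * v t * deriv v t)) ≤ r ^ p * |2 * v t * deriv v t| := by
            rw [← mul_neg]
            gcongr
            exact neg_le_abs _
        _ ≤ t ^ p * |2 * v t * deriv v t| := by
            gcongr
            exact ht.1.le
        _ = t ^ n * (2 * |deriv v t| * (|v t| / Real.sqrt t)) := by
            rw [htp, abs_mul, abs_mul, abs_two]
            ring
        _ ≤ t ^ n * (|deriv v t| ^ 2 + (|v t| / Real.sqrt t) ^ 2) := by
            gcongr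
            exact two_mul_le_add_sq _ _
        _ = _ := by rw [div_pow, hsq, sq_abs, sq_abs]
    · filter_upwards [ae_restrict_mem measurableSet_Ioi] with t ht
      have ht0 : 0 < t := ht
      simp only [Pi.zero_apply]
      positivity
  have hlt : r ^ p * v s ^ 2 < ε := by
    rwa [lt_div_iff₀ hrp, mul_comm] at hs
  rw [hftc] at hbound
  linarith

/-- The norm of the gradient dominates the derivative along the ray through the point. -/
lemma abs_deriv_ray_le_norm_gradient {E : Type*} [NormedAddCommGroup E] [InnerProductSpace ℝ E]
    [CompleteSpace E] {u : E → ℝ} {e x : E} (he : ‖e‖ = 1)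
    (hrad : ∀ x y : E, ‖x‖ = ‖y‖ → u x = u y) (hx : x ≠ 0) (hu : DifferentiableAt ℝ u x) :
    |deriv (fun t : ℝ => u (t • e)) ‖x‖| ≤ ‖gradient u x‖ := by
  have hx0 : ‖x‖ ≠ 0 := norm_ne_zero_iff.2 hx
  set w : E := ‖x‖⁻¹ • x with hw
  have hw1 : ‖w‖ = 1 := by rw [hw, norm_smul, norm_inv, norm_norm, inv_mul_cancel₀ hx0]
  have hwx : ‖x‖ • w = x := by rw [hw, smul_smul, mul_inv_cancel₀ hx0, one_smul]
  have hray : (fun t : ℝ => u (t • e)) = fun t : ℝ => u (t • w) := by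
    funext t
    exact hrad _ _ (by rw [norm_smul, norm_smul, he, hw1])
  have hl : HasDerivAt (fun t : ℝ => t • w) w ‖x‖ := by
    simpa using (hasDerivAt_id ‖x‖).smul_const w
  have hfd : HasFDerivAt u (fderiv ℝ u x) (‖x‖ • w) := by
    rw [hwx]; exact hu.hasFDerivAt
  have hd : deriv (fun t : ℝ => u (t • w)) ‖x‖ = fderiv ℝ u x w :=
    (hfd.comp_hasDerivAt ‖x‖ hl).deriv
  rw [hray, hd, ← inner_gradient_left]
  simpa [hw1] using abs_real_inner_le_norm (gradient u x) w

/-- Radial Sobolev-type pointwise decay estimate for the Coulomb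
Sobolev space `𝓗¹`: for radial `u : ℝ^d → ℝ` (d ≥ 3), continuously differentiable
away from the origin, with
`A = ∫ (|∇u|² + |u|²/|x|) < ∞`, one has `|u(x)| ≤ C |x|^{-(2d-3)/4} A^{1/2}`
for a constant `C` depending only on `d`. -/
theorem stmt0 (d : ℕ) (hd : 3 ≤ d) :
    ∃ C : ℝ, 0 < C ∧
      ∀ (u : EuclideanSpace ℝ (Fin d) → ℝ) (A : ℝ),
        (∀ x y : EuclideanSpace ℝ (Fin d), ‖x‖ = ‖y‖ → u x = u y) →
        ContDiffOn ℝ 1 u {(0 : EuclideanSpace ℝ (Fin d))}ᶜ →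
        Integrable (fun x : EuclideanSpace ℝ (Fin d) =>
          ‖gradient u x‖ ^ 2 + (u x) ^ 2 / ‖x‖) →
        A = ∫ x : EuclideanSpace ℝ (Fin d), (‖gradient u x‖ ^ 2 + (u x) ^ 2 / ‖x‖) →
        ∀ x : EuclideanSpace ℝ (Fin d), x ≠ 0 →
          |u x| ≤ C * ‖x‖ ^ (-(2 * (d : ℝ) - 3) / 4) * Real.sqrt A := by
  have : Nonempty (Fin d) := ⟨⟨0, by omega⟩⟩
  have hω : 0 < volume.real (Metric.ball (0 : EuclideanSpace ℝ (Fin d)) 1) :=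
    ENNReal.toReal_pos (Metric.measure_ball_pos _ _ one_pos).ne' measure_ball_lt_top.ne
  set ω := volume.real (Metric.ball (0 : EuclideanSpace ℝ (Fin d)) 1)
  have hd0 : (0 : ℝ) < d := by
    have : 0 < d := by omega
    exact_mod_cast this
  have hc : 0 < (d : ℝ) * ω := by positivity
  refine ⟨Real.sqrt ((d : ℝ) * ω)⁻¹, Real.sqrt_pos.2 (inv_pos.2 hc), ?_⟩
  intro u A hrad hu hint hA x hx
  obtain ⟨e, he⟩ := exists_norm_eq (EuclideanSpace ℝ (Fin d)) zero_le_one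
  have he0 : e ≠ 0 := by
    rintro rfl
    simp at he
  set v : ℝ → ℝ := fun t => u (t • e) with hv
  have hvu : ∀ y, v ‖y‖ = u y := fun y => hrad _ _ (by rw [norm_smul, he, norm_norm, mul_one])
  have hvc : ContDiffOn ℝ 1 v {(0 : ℝ)}ᶜ :=
    hu.comp (contDiff_id.smul contDiff_const).contDiffOn
      fun t ht => smul_ne_zero ht he0
  have hvm : Measurable v := measurable_of_continuousOn_compl_singleton 0 hvc.continuousOn
  set F : ℝ → ℝ := fun t => deriv v t ^ 2 + v t ^ 2 / t with hF
  have hFm : Measurable F :=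
    ((measurable_deriv v).pow_const 2).add ((hvm.pow_const 2).div measurable_id)
  have hF0 : ∀ y : EuclideanSpace ℝ (Fin d), 0 ≤ F ‖y‖ := fun y => by
    simp only [hF]; positivity
  have hle : ∀ᵐ y : EuclideanSpace ℝ (Fin d),
      F ‖y‖ ≤ ‖gradient u y‖ ^ 2 + u y ^ 2 / ‖y‖ := by
    filter_upwards [Measure.ae_ne volume (0 : EuclideanSpace ℝ (Fin d))] with y hy
    have hdiff : DifferentiableAt ℝ u y :=
      (hu.differentiableOn one_ne_zero).differentiableAt (isOpen_compl_singleton.mem_nhds hy)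
    have h1 := abs_deriv_ray_le_norm_gradient he hrad hy hdiff
    have h2 := pow_le_pow_left₀ (abs_nonneg _) h1 2
    rw [sq_abs] at h2
    simp only [hF, hvu]
    exact add_le_add_left h2 _
  have hFint : Integrable (fun y : EuclideanSpace ℝ (Fin d) => F ‖y‖) := by
    refine hint.mono' (hFm.comp measurable_norm).aestronglyMeasurable ?_
    filter_upwards [hle] with y hy
    rwa [Real.norm_of_nonneg (hF0 y)]
  have hFA : ∫ y : EuclideanSpace ℝ (Fin d), F ‖y‖ ≤ A := by
    rw [hA]
    exact integral_mono_ae hFint hint hle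
  rw [integral_fun_norm_addHaar volume F, finrank_euclideanSpace_fin, nsmul_eq_mul] at hFA
  have hFI := (integrable_fun_norm_addHaar volume (f := F)).1 hFint
  rw [finrank_euclideanSpace_fin] at hFI
  simp only [smul_eq_mul] at hFA hFI
  have hr : 0 < ‖x‖ := norm_pos_iff.2 hx
  have key := rpow_mul_sq_le_integral (n := d - 1) (by omega)
    (hvc.mono fun t ht => (ne_of_gt ht : t ≠ 0)) hFI hr
  have hexp : ((d - 1 : ℕ) : ℝ) - 1 / 2 = (2 * (d : ℝ) - 3) / 2 := by
    rw [Nat.cast_sub (by omega)]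
    push_cast
    ring
  rw [hvu, hexp] at key
  have hsq : (‖x‖ ^ (-(2 * (d : ℝ) - 3) / 4)) ^ 2 = (‖x‖ ^ ((2 * (d : ℝ) - 3) / 2))⁻¹ := by
    rw [← Real.rpow_natCast, ← Real.rpow_mul hr.le, ← Real.rpow_neg hr.le]
    congr 1
    push_cast
    ring
  have hP : 0 < ‖x‖ ^ ((2 * (d : ℝ) - 3) / 2) := by positivity
  set P := ‖x‖ ^ ((2 * (d : ℝ) - 3) / 2)
  have hmain : (d : ℝ) * ω * (P * u x ^ 2) ≤ A := by
    refine le_trans (mul_le_mul_of_nonneg_left key hc.le) ?_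
    rw [mul_assoc]
    exact hFA
  have hA0 : 0 ≤ A := le_trans (by positivity) hmain
  refine abs_le_of_sq_le_sq ?_ (by positivity)
  rw [mul_pow, mul_pow, hsq, Real.sq_sqrt (inv_pos.2 hc).le, Real.sq_sqrt hA0,
    ← mul_inv, inv_mul_eq_div, le_div_iff₀ (by positivity)]
  linarith
end

section
/- Let d ≥ 3 be an integer. Suppose u : ℝ^d → ℝ is radial, continuously differentiable on ℝ^d ∖ {0}, and A := ∫_{ℝ^d} (|∇u(x)|² + |u(x)|²/|x|) dx is finite. Then there exists a constant C depending only on d such that ∫_{ℝ^d} |u(x)|^{(4d-2)/(2d-3)} dx ≤ C · A^{(2d-1)/(2d-3)}; equivalently, the L^{2+4/(2d-3)}(ℝ^d) norm of u is bounded by a dimensional constant times ‖u‖_{𝓗¹}. -/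
open MeasureTheory

open Set in
/-- Radial Strauss-type bound on the half line. -/
theorem rpow_mul_sq_le_integral_Ioi {d : ℕ} (hd : 2 ≤ d) {f : ℝ → ℝ}
    (hf : DifferentiableOn ℝ f (Ioi 0))
    (hint : IntegrableOn (fun s => s ^ (d - 1) * (deriv f s ^ 2 + f s ^ 2 / s)) (Ioi 0))
    {r : ℝ} (hr : 0 < r) :
    r ^ ((d : ℝ) - 3 / 2) * f r ^ 2 ≤
      ∫ s in Ioi (0 : ℝ), s ^ (d - 1) * (deriv f s ^ 2 + f s ^ 2 / s) := by
  obtain ⟨k, rfl⟩ := Nat.exists_eq_add_of_le' hd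
  have hk : k + 2 - 1 = k + 1 := rfl
  have hexp : ((k + 2 : ℕ) : ℝ) - 3 / 2 = k + 1 / 2 := by push_cast; ring
  rw [hk] at hint ⊢
  rw [hexp]
  set F : ℝ → ℝ := fun s => s ^ (k + 1) * (deriv f s ^ 2 + f s ^ 2 / s) with hF
  have hsub : Ioi r ⊆ Ioi 0 := Ioi_subset_Ioi hr.le
  have hFr : IntegrableOn F (Ioi r) := hint.mono_set hsub
  have hF0 : ∀ s ∈ Ioi (0 : ℝ), 0 ≤ F s := fun s hs => by
    have : (0 : ℝ) < s := hs
    simp only [hF]; positivity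
  have hderiv : ∀ s ∈ Ioi (0 : ℝ), HasDerivAt f (deriv f s) s := fun s hs =>
    (hf.differentiableAt (Ioi_mem_nhds hs)).hasDerivAt
  have hsq : ∀ s ∈ Ioi (0 : ℝ), HasDerivAt (fun t => f t ^ 2) (2 * f s * deriv f s) s :=
    fun s hs => by simpa using (hderiv s hs).fun_pow 2
  have hfmeas : AEStronglyMeasurable f (volume.restrict (Ioi r)) :=
    (hf.continuousOn.mono hsub).aestronglyMeasurable measurableSet_Ioi
  have hfmeas' : AEStronglyMeasurable (deriv f) (volume.restrict (Ioi r)) :=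
    (measurable_deriv f).aestronglyMeasurable
  have hsq_le : ∀ s ∈ Ioi r, r ^ k * f s ^ 2 ≤ F s := fun s hs => by
    have hs' : r < s := hs
    have hs0 : 0 < s := hr.trans hs'
    have h1 : F s = s ^ (k + 1) * deriv f s ^ 2 + s ^ k * f s ^ 2 := by
      simp only [hF]; field_simp; ring
    have h2 : r ^ k * f s ^ 2 ≤ s ^ k * f s ^ 2 := by gcongr
    have h3 : 0 ≤ s ^ (k + 1) * deriv f s ^ 2 := by positivity
    linarith
  have hprod_le : ∀ s ∈ Ioi r, r ^ ((k : ℝ) + 1 / 2) * |2 * f s * deriv f s| ≤ F s :=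
      fun s hs => by
    have hs' : r < s := hs
    have hs0 : 0 < s := hr.trans hs'
    have h1 : r ^ ((k : ℝ) + 1 / 2) ≤ s ^ k * √s := by
      rw [Real.sqrt_eq_rpow, ← Real.rpow_natCast s k, ← Real.rpow_add hs0]
      gcongr
    have h2 : F s = s ^ k * ((√s * |deriv f s|) ^ 2 + |f s| ^ 2) := by
      simp only [hF, mul_pow, sq_abs, Real.sq_sqrt hs0.le]; field_simp; ring
    calc r ^ ((k : ℝ) + 1 / 2) * |2 * f s * deriv f s|
        ≤ s ^ k * √s * |2 * f s * deriv f s| := by gcongr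
      _ = s ^ k * (2 * (√s * |deriv f s|) * |f s|) := by
          rw [abs_mul, abs_mul, abs_two]; ring
      _ ≤ F s := by
          rw [h2]; gcongr; exact two_mul_le_add_sq _ _
  have hrk : 0 < r ^ ((k : ℝ) + 1 / 2) := by positivity
  have hsq_int : IntegrableOn (fun s => f s ^ 2) (Ioi r) := by
    refine (hFr.div_const (r ^ k)).mono' (hfmeas.pow 2) ?_
    filter_upwards [ae_restrict_mem measurableSet_Ioi] with s hs
    rw [Real.norm_of_nonneg (sq_nonneg _), le_div_iff₀' (by positivity)]
    exact hsq_le s hs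
  have hprod_int : IntegrableOn (fun s => 2 * f s * deriv f s) (Ioi r) := by
    refine (hFr.div_const (r ^ ((k : ℝ) + 1 / 2))).mono' ((hfmeas.const_mul 2).mul hfmeas') ?_
    filter_upwards [ae_restrict_mem measurableSet_Ioi] with s hs
    rw [Real.norm_eq_abs, le_div_iff₀' hrk]
    exact hprod_le s hs
  have hlim := tendsto_zero_of_hasDerivAt_of_integrableOn_Ioi
    (fun s hs => hsq s (hsub hs)) hprod_int hsq_int
  have hftc := integral_Ioi_of_hasDerivAt_of_tendsto
    (hsq r hr).continuousAt.continuousWithinAt (fun s hs => hsq s (hsub hs)) hprod_int hlim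
  calc r ^ ((k : ℝ) + 1 / 2) * f r ^ 2
      = ∫ s in Ioi r, r ^ ((k : ℝ) + 1 / 2) * -(2 * f s * deriv f s) := by
        rw [integral_const_mul, integral_neg, hftc]; ring
    _ ≤ ∫ s in Ioi r, F s := by
        refine setIntegral_mono_on (hprod_int.neg.const_mul _) hFr measurableSet_Ioi
          fun s hs => (mul_le_mul_of_nonneg_left (neg_le_abs _) hrk.le).trans (hprod_le s hs)
    _ ≤ ∫ s in Ioi (0 : ℝ), F s :=
        setIntegral_mono_set hint ((ae_restrict_mem measurableSet_Ioi).mono hF0)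
          hsub.eventuallyLE

open Set in
/-- In the direction of a point `x ≠ 0`, the slope of a radial function is controlled by its
gradient. -/
theorem radial_profile_deriv {E : Type*} [NormedAddCommGroup E] [InnerProductSpace ℝ E]
    [CompleteSpace E] {u : E → ℝ} (hrad : ∀ x y : E, ‖x‖ = ‖y‖ → u x = u y)
    (hu : DifferentiableOn ℝ u {0}ᶜ) {e : E} (he : ‖e‖ = 1) {x : E} (hx : x ≠ 0) :
    DifferentiableAt ℝ (fun t : ℝ => u (t • e)) ‖x‖ ∧
      |deriv (fun t : ℝ => u (t • e)) ‖x‖| ≤ ‖gradient u x‖ := by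
  have hx' : ‖x‖ ≠ 0 := norm_ne_zero_iff.2 hx
  have hunit : ‖‖x‖⁻¹ • x‖ = 1 := by rw [norm_smul, norm_inv, norm_norm, inv_mul_cancel₀ hx']
  have heq : (fun t : ℝ => u (t • e)) = fun t : ℝ => u (t • (‖x‖⁻¹ • x)) := by
    funext t
    exact hrad _ _ (by rw [norm_smul, norm_smul, he, hunit])
  have hpt : ‖x‖ • (‖x‖⁻¹ • x) = x := smul_inv_smul₀ hx' x
  have hux : HasFDerivAt u (fderiv ℝ u x) (‖x‖ • (‖x‖⁻¹ • x)) := by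
    rw [hpt]
    exact (hu.differentiableAt (isOpen_compl_singleton.mem_nhds hx)).hasFDerivAt
  have hd : HasDerivAt (fun t : ℝ => u (t • e)) (fderiv ℝ u x (‖x‖⁻¹ • x)) ‖x‖ := by
    rw [heq]
    have hline : HasDerivAt (fun t : ℝ => t • (‖x‖⁻¹ • x)) (‖x‖⁻¹ • x) ‖x‖ := by
      simpa using (hasDerivAt_id ‖x‖).smul_const (‖x‖⁻¹ • x)
    exact hux.comp_hasDerivAt _ hline
  refine ⟨hd.differentiableAt, ?_⟩
  rw [hd.deriv, gradient, LinearIsometryEquiv.norm_map, ← Real.norm_eq_abs]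
  simpa [hunit] using (fderiv ℝ u x).le_opNorm (‖x‖⁻¹ • x)

open Set in
/-- Pointwise decay of radial functions of finite Coulomb Sobolev energy. -/
theorem radial_sq_le {d : ℕ} (hd : 2 ≤ d) {u : EuclideanSpace ℝ (Fin d) → ℝ}
    (hrad : ∀ x y : EuclideanSpace ℝ (Fin d), ‖x‖ = ‖y‖ → u x = u y)
    (hu : DifferentiableOn ℝ u {0}ᶜ)
    (hint : Integrable fun x : EuclideanSpace ℝ (Fin d) =>
      ‖gradient u x‖ ^ 2 + u x ^ 2 / ‖x‖)
    {x : EuclideanSpace ℝ (Fin d)} (hx : x ≠ 0) :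
    d * volume.real (Metric.ball (0 : EuclideanSpace ℝ (Fin d)) 1) *
        (‖x‖ ^ ((d : ℝ) - 3 / 2) * u x ^ 2) ≤
      ∫ y : EuclideanSpace ℝ (Fin d), (‖gradient u y‖ ^ 2 + u y ^ 2 / ‖y‖) := by
  have : Nontrivial (EuclideanSpace ℝ (Fin d)) := ⟨x, 0, hx⟩
  obtain ⟨e, he⟩ := exists_norm_eq (EuclideanSpace ℝ (Fin d)) zero_le_one
  set f : ℝ → ℝ := fun t => u (t • e) with hf
  have huf : ∀ y, f ‖y‖ = u y := fun y => hrad _ _ (by rw [norm_smul, he, norm_norm, mul_one])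
  have hfd : DifferentiableOn ℝ f (Ioi 0) := fun t ht => by
    have ht' : (0 : ℝ) < t := ht
    have hte : ‖t • e‖ = t := by rw [norm_smul, he, Real.norm_of_nonneg ht'.le, mul_one]
    have := (radial_profile_deriv hrad hu he (x := t • e)
      (norm_ne_zero_iff.1 (by rw [hte]; exact ht'.ne'))).1
    rw [hte] at this
    exact this.differentiableWithinAt
  have hae : ∀ᵐ y : EuclideanSpace ℝ (Fin d), y ≠ 0 := by
    simp [ae_iff]
  have hle : ∀ᵐ y : EuclideanSpace ℝ (Fin d),
      deriv f ‖y‖ ^ 2 + f ‖y‖ ^ 2 / ‖y‖ ≤ ‖gradient u y‖ ^ 2 + u y ^ 2 / ‖y‖ := by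
    filter_upwards [hae] with y hy
    have := (radial_profile_deriv hrad hu he hy).2
    rw [huf, ← sq_abs (deriv f ‖y‖)]
    gcongr
  have humeas : AEStronglyMeasurable u := by
    have := hu.continuousOn.aestronglyMeasurable (μ := volume)
      (measurableSet_singleton (0 : EuclideanSpace ℝ (Fin d))).compl
    rwa [restrict_compl_singleton] at this
  have hradint : Integrable fun y : EuclideanSpace ℝ (Fin d) =>
      deriv f ‖y‖ ^ 2 + f ‖y‖ ^ 2 / ‖y‖ := by
    refine hint.mono' ?_ ?_
    · simp only [huf]
      have h1 : Measurable fun y : EuclideanSpace ℝ (Fin d) => deriv f ‖y‖ ^ 2 :=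
        ((measurable_deriv f).comp measurable_norm).pow_const 2
      exact (h1.aemeasurable.add
        ((humeas.aemeasurable.pow_const 2).div measurable_norm.aemeasurable)).aestronglyMeasurable
    · filter_upwards [hle] with y hy
      rwa [Real.norm_of_nonneg (by positivity)]
  have hpolar := integral_fun_norm_addHaar (volume : Measure (EuclideanSpace ℝ (Fin d)))
    fun s => deriv f s ^ 2 + f s ^ 2 / s
  have hint1 := (integrable_fun_norm_addHaar (volume : Measure (EuclideanSpace ℝ (Fin d)))
    (f := fun s => deriv f s ^ 2 + f s ^ 2 / s)).1 hradint
  simp only [finrank_euclideanSpace, Fintype.card_fin, smul_eq_mul, nsmul_eq_mul] at hpolar hint1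
  have hdecay := rpow_mul_sq_le_integral_Ioi hd hfd hint1 (norm_pos_iff.2 hx)
  rw [huf] at hdecay
  calc _ ≤ d * volume.real (Metric.ball (0 : EuclideanSpace ℝ (Fin d)) 1) *
        ∫ s in Ioi (0 : ℝ), s ^ (d - 1) * (deriv f s ^ 2 + f s ^ 2 / s) := by gcongr
    _ = ∫ y : EuclideanSpace ℝ (Fin d), (deriv f ‖y‖ ^ 2 + f ‖y‖ ^ 2 / ‖y‖) := by
        rw [hpolar]; ring
    _ ≤ _ := integral_mono_ae hradint hint hle

/-- Radial Sobolev embedding `𝓗¹ ↪ L^{2+4/(2d-3)}`: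
for radial `u : ℝ^d → ℝ` (d ≥ 3), `C¹` away from the origin, with
`A = ∫ (|∇u|² + |u|²/|x|) < ∞`, one has
`∫ |u|^{(4d-2)/(2d-3)} ≤ C · A^{(2d-1)/(2d-3)}` for a constant `C = C(d)`. -/
theorem stmt1 (d : ℕ) (hd : 3 ≤ d) :
    ∃ C : ℝ, 0 < C ∧
      ∀ (u : EuclideanSpace ℝ (Fin d) → ℝ) (A : ℝ),
        (∀ x y : EuclideanSpace ℝ (Fin d), ‖x‖ = ‖y‖ → u x = u y) →
        ContDiffOn ℝ 1 u {(0 : EuclideanSpace ℝ (Fin d))}ᶜ →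
        Integrable (fun x : EuclideanSpace ℝ (Fin d) =>
          ‖gradient u x‖ ^ 2 + (u x) ^ 2 / ‖x‖) →
        A = ∫ x : EuclideanSpace ℝ (Fin d), (‖gradient u x‖ ^ 2 + (u x) ^ 2 / ‖x‖) →
        ∫ x : EuclideanSpace ℝ (Fin d), |u x| ^ ((4 * (d : ℝ) - 2) / (2 * (d : ℝ) - 3))
          ≤ C * A ^ ((2 * (d : ℝ) - 1) / (2 * (d : ℝ) - 3)) := by
  have hd' : (3 : ℝ) ≤ d := by exact_mod_cast hd
  have : Nonempty (Fin d) := ⟨⟨0, by omega⟩⟩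
  set ω : ℝ := d * volume.real (Metric.ball (0 : EuclideanSpace ℝ (Fin d)) 1) with hω
  have hω0 : 0 < ω :=
    mul_pos (by linarith) (ENNReal.toReal_pos (Metric.measure_ball_pos _ _ one_pos).ne'
      measure_ball_lt_top.ne)
  have hb : 0 < 2 * (d : ℝ) - 3 := by linarith
  have hb' : 2 * (d : ℝ) - 3 ≠ 0 := hb.ne'
  set q : ℝ := 2 / (2 * (d : ℝ) - 3) with hq
  have hq0 : 0 < q := by positivity
  have hqb : q * (2 * (d : ℝ) - 3) = 2 := div_mul_cancel₀ _ hb'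
  refine ⟨(1 / ω) ^ q, by positivity, fun u A hrad hu hint hA => ?_⟩
  have hud : DifferentiableOn ℝ u {0}ᶜ := hu.differentiableOn one_ne_zero
  have hae : ∀ᵐ y : EuclideanSpace ℝ (Fin d), y ≠ 0 := by simp [ae_iff]
  have humeas : AEStronglyMeasurable u := by
    have := hu.continuousOn.aestronglyMeasurable (μ := volume)
      (measurableSet_singleton (0 : EuclideanSpace ℝ (Fin d))).compl
    rwa [restrict_compl_singleton] at this
  have hA0 : 0 ≤ A := hA ▸ integral_nonneg fun x => by positivity
  have hle : ∀ x : EuclideanSpace ℝ (Fin d),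
      u x ^ 2 / ‖x‖ ≤ ‖gradient u x‖ ^ 2 + u x ^ 2 / ‖x‖ := fun x =>
    le_add_of_nonneg_left (by positivity)
  have hpot : Integrable fun x : EuclideanSpace ℝ (Fin d) => u x ^ 2 / ‖x‖ := by
    refine hint.mono' ((humeas.aemeasurable.pow_const 2).div
      measurable_norm.aemeasurable).aestronglyMeasurable (ae_of_all _ fun x => ?_)
    rw [Real.norm_of_nonneg (by positivity)]
    exact hle x
  have hexp : (4 * (d : ℝ) - 2) / (2 * (d : ℝ) - 3) = 2 + 2 * q := by
    rw [div_eq_iff hb']; linear_combination -2 * hqb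
  have hexp' : (2 * (d : ℝ) - 1) / (2 * (d : ℝ) - 3) = q + 1 := by
    rw [div_eq_iff hb']; linear_combination -hqb
  have hqd : ((d : ℝ) - 3 / 2) * q = 1 := by
    linear_combination hqb / 2
  rw [hexp, hexp']
  have hpt : ∀ᵐ x : EuclideanSpace ℝ (Fin d),
      |u x| ^ (2 + 2 * q) ≤ (1 / ω * A) ^ q * (u x ^ 2 / ‖x‖) := by
    filter_upwards [hae] with x hx
    have hx0 : 0 < ‖x‖ := norm_pos_iff.2 hx
    have hdec := radial_sq_le (by omega) hrad hud hint hx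
    rw [← hA, ← hω] at hdec
    have hdec' : ‖x‖ ^ ((d : ℝ) - 3 / 2) * u x ^ 2 ≤ 1 / ω * A := by
      rw [one_div, ← div_eq_inv_mul, le_div_iff₀' hω0]
      exact hdec
    have hpow : ‖x‖ * (u x ^ 2) ^ q ≤ (1 / ω * A) ^ q := by
      have := Real.rpow_le_rpow (by positivity) hdec' hq0.le
      rwa [Real.mul_rpow (by positivity) (by positivity), ← Real.rpow_mul hx0.le, hqd,
        Real.rpow_one] at this
    calc |u x| ^ (2 + 2 * q) = (‖x‖ * (u x ^ 2) ^ q) * (u x ^ 2 / ‖x‖) := by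
          rw [Real.rpow_add_of_nonneg (abs_nonneg _) zero_le_two (by positivity),
            Real.rpow_mul (abs_nonneg _), Real.rpow_two, sq_abs]
          field_simp
      _ ≤ _ := by gcongr
  calc ∫ x : EuclideanSpace ℝ (Fin d), |u x| ^ (2 + 2 * q)
      ≤ ∫ x : EuclideanSpace ℝ (Fin d), (1 / ω * A) ^ q * (u x ^ 2 / ‖x‖) :=
        integral_mono_of_nonneg (ae_of_all _ fun x => by positivity) (hpot.const_mul _) hpt
    _ = (1 / ω * A) ^ q * ∫ x : EuclideanSpace ℝ (Fin d), u x ^ 2 / ‖x‖ :=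
        integral_const_mul _ _
    _ ≤ (1 / ω * A) ^ q * A := by
        gcongr
        rw [hA]
        exact integral_mono hpot hint hle
    _ = (1 / ω) ^ q * A ^ (q + 1) := by
        rw [Real.mul_rpow (by positivity) hA0,
          Real.rpow_add_of_nonneg hA0 hq0.le zero_le_one, Real.rpow_one, mul_assoc]
end

section
/- Let d ≥ 3 be an integer. Suppose u : ℝ^d → ℝ is radial, continuously differentiable on ℝ^d ∖ {0}, and A := ∫_{ℝ^d} (|∇u(x)|² + |u(x)|²/|x|) dx is finite. Then there exists a constant C depending only on d such that for every real q ≥ 2 + 4/(2d-3) and every R > 0, (∫_{|x|>R} |u(x)|^q dx)^{1/q} ≤ C · R^{-((2d-3)/4)·((q-2)/q) + 1/q} · A^{1/2}. -/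
open MeasureTheory

/-- Strauss-type pointwise bound for a function on the half-line with finite weighted energy. -/
theorem sq_mul_pow_mul_sqrt_le_integral (m : ℕ) (f : ℝ → ℝ)
    (hf : ∀ r, 0 < r → DifferentiableAt ℝ f r)
    (hint : IntegrableOn (fun t => t ^ (m + 1) * (deriv f t ^ 2 + f t ^ 2 / t)) (Set.Ioi 0))
    {r : ℝ} (hr : 0 < r) :
    r ^ m * √r * f r ^ 2 ≤
      ∫ t in Set.Ioi 0, t ^ (m + 1) * (deriv f t ^ 2 + f t ^ 2 / t) := by
  set φ : ℝ → ℝ := fun t => t ^ (m + 1) * (deriv f t ^ 2 + f t ^ 2 / t) with hφ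
  have hφ0 : ∀ t, 0 < t → 0 ≤ φ t := fun t ht => by simp only [hφ]; positivity
  have hφ_eq : ∀ t, 0 < t → φ t = t ^ m * (t * deriv f t ^ 2 + f t ^ 2) := by
    intro t ht
    simp only [hφ]
    field_simp
    ring
  have hderiv : ∀ t, 0 < t → HasDerivAt (fun t => -(t ^ m * √t * f t ^ 2))
      (-((m * t ^ (m - 1) * √t + t ^ m * (1 / (2 * √t))) * f t ^ 2
        + t ^ m * √t * (2 * f t * deriv f t))) t := by
    intro t ht
    have h := (((hasDerivAt_pow m t).mul (Real.hasDerivAt_sqrt ht.ne')).mul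
      ((hf t ht).hasDerivAt.pow 2)).neg
    refine h.congr_deriv ?_
    simp
  have hderiv_le : ∀ t, 0 < t →
      -((m * t ^ (m - 1) * √t + t ^ m * (1 / (2 * √t))) * f t ^ 2
        + t ^ m * √t * (2 * f t * deriv f t)) ≤ φ t := by
    intro t ht
    have h1 : 0 ≤ (m * t ^ (m - 1) * √t + t ^ m * (1 / (2 * √t))) * f t ^ 2 := by positivity
    have h2 : 0 ≤ t ^ m * (√t * deriv f t + f t) ^ 2 := by positivity
    have h4 : t ^ m * (√t * deriv f t + f t) ^ 2
        = t ^ m * (t * deriv f t ^ 2 + f t ^ 2) + t ^ m * √t * (2 * f t * deriv f t) := by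
      have := Real.sq_sqrt ht.le
      linear_combination t ^ m * deriv f t ^ 2 * this
    linarith [hφ_eq t ht]
  have hmain : ∀ s, r < s →
      r ^ m * √r * f r ^ 2 - ∫ t in Set.Ioi 0, φ t ≤ s ^ m * √s * f s ^ 2 := by
    intro s hs
    have h := intervalIntegral.sub_le_integral_of_hasDeriv_right_of_le hs.le
      (fun t ht => (hderiv t (hr.trans_le ht.1)).continuousAt.continuousWithinAt)
      (fun t ht => (hderiv t (hr.trans ht.1)).hasDerivWithinAt)
      (hint.mono_set fun t ht => hr.trans_le ht.1)
      (fun t ht => hderiv_le t (hr.trans ht.1))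
    have h2 : ∫ t in r..s, φ t ≤ ∫ t in Set.Ioi 0, φ t := by
      rw [intervalIntegral.integral_of_le hs.le]
      refine setIntegral_mono_set hint ?_ (ae_of_all _ fun t ht => hr.trans ht.1)
      exact (ae_restrict_iff' measurableSet_Ioi).2 (ae_of_all _ hφ0)
    linarith
  by_contra! hlt
  set c := r ^ m * √r * f r ^ 2 - ∫ t in Set.Ioi 0, φ t
  have hc : 0 < c := sub_pos.2 hlt
  have hI : IntegrableOn (fun t : ℝ => t ^ (-1 / 2 : ℝ)) (Set.Ioi r) := by
    refine Integrable.mono' (g := fun t => c⁻¹ * φ t)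
      ((hint.mono_set fun t ht => hr.trans ht).const_mul _)
      (by fun_prop) ?_
    refine (ae_restrict_iff' measurableSet_Ioi).2 (ae_of_all _ fun t ht => ?_)
    have ht0 : 0 < t := hr.trans ht
    have hs : 0 < √t := Real.sqrt_pos.2 ht0
    rw [Real.norm_of_nonneg (by positivity), le_inv_mul_iff₀ hc]
    have e1 : t ^ (-1 / 2 : ℝ) = (√t)⁻¹ := by
      rw [Real.sqrt_eq_rpow, ← Real.rpow_neg ht0.le]; norm_num
    rw [e1, ← div_eq_mul_inv, div_le_iff₀ hs]
    have h5 : t ^ m * f t ^ 2 ≤ φ t := by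
      rw [hφ_eq t ht0]
      have : 0 ≤ t * deriv f t ^ 2 := by positivity
      gcongr
      linarith
    have := hmain t ht
    nlinarith
  rw [integrableOn_Ioi_rpow_iff hr] at hI
  norm_num at hI

/-- Strauss-type bound for radial functions with finite Coulomb Sobolev energy. -/
theorem sq_mul_pow_mul_sqrt_le_of_radial (d : ℕ) (hd : 2 ≤ d)
    (u : EuclideanSpace ℝ (Fin d) → ℝ)
    (hu : ∀ x y : EuclideanSpace ℝ (Fin d), ‖x‖ = ‖y‖ → u x = u y)
    (hC : ContDiffOn ℝ 1 u {(0 : EuclideanSpace ℝ (Fin d))}ᶜ)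
    (hint : Integrable (fun x : EuclideanSpace ℝ (Fin d) =>
      ‖gradient u x‖ ^ 2 + (u x) ^ 2 / ‖x‖))
    (x : EuclideanSpace ℝ (Fin d)) (hx : x ≠ 0) :
    d * volume.real (Metric.ball (0 : EuclideanSpace ℝ (Fin d)) 1) *
      (‖x‖ ^ (d - 2) * √‖x‖ * u x ^ 2) ≤
      ∫ x : EuclideanSpace ℝ (Fin d), (‖gradient u x‖ ^ 2 + (u x) ^ 2 / ‖x‖) := by
  obtain ⟨m, rfl⟩ : ∃ m, d = m + 2 := ⟨d - 2, by omega⟩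
  have hdiff : ∀ y, y ≠ 0 → DifferentiableAt ℝ u y := fun y hy =>
    (hC.differentiableOn (by norm_num)).differentiableAt (isOpen_compl_singleton.mem_nhds hy)
  have hcomp : ∀ e : EuclideanSpace ℝ (Fin (m + 2)), ‖e‖ = 1 → ∀ r : ℝ, 0 < r →
      HasDerivAt (fun t : ℝ => u (t • e)) (fderiv ℝ u (r • e) e) r := by
    intro e he r hr
    have hne : r • e ≠ 0 := by
      rw [← norm_pos_iff, norm_smul, he]; simp [hr.ne']
    have h1 : HasDerivAt (fun t : ℝ => t • e) e r := by
      simpa using (hasDerivAt_id r).smul_const e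
    exact (hdiff _ hne).hasFDerivAt.comp_hasDerivAt r h1
  obtain ⟨e₀, he₀⟩ : ∃ e : EuclideanSpace ℝ (Fin (m + 2)), ‖e‖ = 1 :=
    exists_norm_eq _ zero_le_one
  set f : ℝ → ℝ := fun t => u (t • e₀) with hf
  have hfu : ∀ y, f ‖y‖ = u y := fun y => hu _ _ (by simp [norm_smul, he₀])
  have hderiv : ∀ y, y ≠ 0 → deriv f ‖y‖ ^ 2 ≤ ‖gradient u y‖ ^ 2 := by
    intro y hy
    have hn : 0 < ‖y‖ := norm_pos_iff.2 hy
    have hunit : ‖‖y‖⁻¹ • y‖ = 1 := norm_smul_inv_norm hy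
    have hyy : ‖y‖ • ‖y‖⁻¹ • y = y := smul_inv_smul₀ hn.ne' y
    have h1 := hcomp (‖y‖⁻¹ • y) hunit ‖y‖ hn
    have h2 : f = fun t : ℝ => u (t • ‖y‖⁻¹ • y) := by
      funext t; exact hu _ _ (by rw [norm_smul, norm_smul, he₀, hunit])
    rw [h2, h1.deriv, hyy, ← sq_abs]
    have h3 : ‖gradient u y‖ = ‖fderiv ℝ u y‖ := by
      rw [← toDual_gradient, LinearIsometryEquiv.norm_map]
    rw [h3]
    have h4 := (fderiv ℝ u y).le_opNorm (‖y‖⁻¹ • y)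
    rw [hunit, mul_one, Real.norm_eq_abs] at h4
    gcongr
  set h : ℝ → ℝ := fun t => deriv f t ^ 2 + f t ^ 2 / t with hh
  have hle : ∀ᵐ y : EuclideanSpace ℝ (Fin (m + 2)),
      h ‖y‖ ≤ ‖gradient u y‖ ^ 2 + (u y) ^ 2 / ‖y‖ := by
    filter_upwards [compl_mem_ae_iff.2 (measure_singleton (0 : EuclideanSpace ℝ (Fin (m + 2))))]
      with y hy
    simp only [hh, hfu]
    gcongr ?_ + _
    exact hderiv y hy
  have humeas : AEStronglyMeasurable u volume := by
    have := hC.continuousOn.aestronglyMeasurable (μ := volume)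
      (measurableSet_singleton (0 : EuclideanSpace ℝ (Fin (m + 2)))).compl
    rwa [restrict_compl_singleton] at this
  have hmeas : AEStronglyMeasurable
      (fun y : EuclideanSpace ℝ (Fin (m + 2)) => h ‖y‖) volume := by
    simp only [hh, hfu]
    have := (measurable_deriv f).comp
      (measurable_norm (α := EuclideanSpace ℝ (Fin (m + 2))))
    exact ((this.pow_const 2).aemeasurable.add
      ((humeas.aemeasurable.pow_const 2).div measurable_norm.aemeasurable)).aestronglyMeasurable
  have hhint : Integrable (fun y : EuclideanSpace ℝ (Fin (m + 2)) => h ‖y‖) := by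
    refine hint.mono' hmeas ?_
    filter_upwards [hle] with y hy
    rwa [Real.norm_of_nonneg]
    simp only [hh]; positivity
  have hI := (integral_fun_norm_addHaar
    (volume : Measure (EuclideanSpace ℝ (Fin (m + 2)))) h).symm.trans_le
    (integral_mono_ae hhint hint hle)
  rw [integrable_fun_norm_addHaar] at hhint
  simp only [finrank_euclideanSpace_fin, smul_eq_mul, nsmul_eq_mul,
    show m + 2 - 1 = m + 1 from rfl] at hI hhint
  refine le_trans ?_ hI
  rw [mul_assoc]
  gcongr
  rw [← hfu x]
  exact sq_mul_pow_mul_sqrt_le_integral m f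
    (fun r hr => (hcomp e₀ he₀ r hr).differentiableAt) hhint (norm_pos_iff.2 hx)


/-- Exterior decay of `L^q` norms of radial `𝓗¹` functions:
for radial `u : ℝ^d → ℝ` (d ≥ 3), `C¹` away from the origin, with
`A = ∫ (|∇u|² + |u|²/|x|) < ∞`, for every `q ≥ 2 + 4/(2d-3)` and `R > 0`,
`‖u‖_{L^q(|x|>R)} ≤ C · R^{-((2d-3)/4)·((q-2)/q) + 1/q} · A^{1/2}`, with `C = C(d)`. -/
theorem stmt2 (d : ℕ) (hd : 3 ≤ d) :
    ∃ C : ℝ, 0 < C ∧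
      ∀ (u : EuclideanSpace ℝ (Fin d) → ℝ) (A : ℝ),
        (∀ x y : EuclideanSpace ℝ (Fin d), ‖x‖ = ‖y‖ → u x = u y) →
        ContDiffOn ℝ 1 u {(0 : EuclideanSpace ℝ (Fin d))}ᶜ →
        Integrable (fun x : EuclideanSpace ℝ (Fin d) =>
          ‖gradient u x‖ ^ 2 + (u x) ^ 2 / ‖x‖) →
        A = ∫ x : EuclideanSpace ℝ (Fin d), (‖gradient u x‖ ^ 2 + (u x) ^ 2 / ‖x‖) →
        ∀ q R : ℝ, 2 + 4 / (2 * (d : ℝ) - 3) ≤ q → 0 < R →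
          (∫ x in {x : EuclideanSpace ℝ (Fin d) | R < ‖x‖}, |u x| ^ q) ^ (1 / q)
            ≤ C * R ^ (-((2 * (d : ℝ) - 3) / 4) * ((q - 2) / q) + 1 / q) * Real.sqrt A := by

  have hd' : (3 : ℝ) ≤ d := by exact_mod_cast hd
  have hω : 0 < (d : ℝ) * volume.real (Metric.ball (0 : EuclideanSpace ℝ (Fin d)) 1) :=
    mul_pos (by linarith) (ENNReal.toReal_pos (Metric.measure_ball_pos _ _ one_pos).ne'
      measure_ball_lt_top.ne)
  set ω := (d : ℝ) * volume.real (Metric.ball (0 : EuclideanSpace ℝ (Fin d)) 1)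
  refine ⟨max 1 ω⁻¹, by positivity, ?_⟩
  intro u A hu hC hint hA q R hq hR
  set C := max 1 ω⁻¹
  have hC1 : 1 ≤ C := le_max_left _ _
  have hA0 : 0 ≤ A := by rw [hA]; exact integral_nonneg fun x => by positivity
  have hd3 : 0 < 2 * (d : ℝ) - 3 := by linarith
  have hq4 : 4 ≤ (q - 2) * (2 * d - 3) := by
    rw [← div_le_iff₀ hd3]; linarith
  have hq2 : 0 < q - 2 := by
    have : 0 < 4 / (2 * (d : ℝ) - 3) := by positivity
    linarith
  have hq0 : 0 < q := by linarith
  set k : ℝ := (2 * d - 3) / 2 with hk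
  set e : ℝ := 1 - k * ((q - 2) / 2) with he
  have he0 : e ≤ 0 := by rw [he, hk]; linarith
  have hpt : ∀ x, x ≠ 0 → u x ^ 2 ≤ C * A * ‖x‖ ^ (-k) := by
    intro x hx
    have hn : 0 < ‖x‖ := norm_pos_iff.2 hx
    have h := sq_mul_pow_mul_sqrt_le_of_radial d (by omega) u hu hC hint x hx
    rw [← hA] at h
    have hpow : ‖x‖ ^ (d - 2) * √‖x‖ = ‖x‖ ^ k := by
      rw [Real.sqrt_eq_rpow, ← Real.rpow_natCast, ← Real.rpow_add hn, hk,
        Nat.cast_sub (by omega)]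
      congr 1; push_cast; ring
    rw [hpow] at h
    rw [Real.rpow_neg hn.le, ← div_eq_mul_inv, le_div_iff₀ (by positivity)]
    calc u x ^ 2 * ‖x‖ ^ k = ω⁻¹ * (ω * (‖x‖ ^ k * u x ^ 2)) := by field_simp
      _ ≤ C * A := mul_le_mul (le_max_right _ _) h (by positivity) (by positivity)
  have hbound : ∀ x, R < ‖x‖ →
      |u x| ^ q ≤ (C * A) ^ ((q - 2) / 2) * R ^ e * (‖gradient u x‖ ^ 2 + u x ^ 2 / ‖x‖) := by
    intro x hx
    have hn : 0 < ‖x‖ := hR.trans hx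
    have h1 : |u x| ^ q = (u x ^ 2) ^ ((q - 2) / 2) * u x ^ 2 := by
      rw [← sq_abs (u x), ← Real.rpow_natCast, ← Real.rpow_mul (abs_nonneg _),
        ← Real.rpow_add_of_nonneg (abs_nonneg _) (by push_cast; linarith) (by norm_num)]
      congr 1; push_cast; ring
    have h2 : (u x ^ 2) ^ ((q - 2) / 2) ≤
        (C * A) ^ ((q - 2) / 2) * ‖x‖ ^ (-(k * ((q - 2) / 2))) := by
      refine (Real.rpow_le_rpow (sq_nonneg _) (hpt x (norm_pos_iff.1 hn))
        (by linarith)).trans_eq ?_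
      rw [Real.mul_rpow (by positivity) (by positivity), ← Real.rpow_mul hn.le, neg_mul]
    have h3 : ‖x‖ ^ (-(k * ((q - 2) / 2))) = ‖x‖ ^ e / ‖x‖ := by
      rw [← Real.rpow_sub_one hn.ne']; congr 1; rw [he]; ring
    have h4 : ‖x‖ ^ e ≤ R ^ e := Real.rpow_le_rpow_of_nonpos hR hx.le he0
    calc |u x| ^ q ≤ (C * A) ^ ((q - 2) / 2) * (‖x‖ ^ e / ‖x‖) * u x ^ 2 := by
          rw [h1, ← h3]; gcongr
      _ = (C * A) ^ ((q - 2) / 2) * ‖x‖ ^ e * (u x ^ 2 / ‖x‖) := by ring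
      _ ≤ _ := by
          gcongr
          linarith [sq_nonneg ‖gradient u x‖]
  have hInt : ∫ x in {x : EuclideanSpace ℝ (Fin d) | R < ‖x‖}, |u x| ^ q
      ≤ (C * A) ^ ((q - 2) / 2) * R ^ e * A := by
    have hms : MeasurableSet {x : EuclideanSpace ℝ (Fin d) | R < ‖x‖} :=
      measurableSet_lt measurable_const measurable_norm
    refine (integral_mono_of_nonneg (ae_of_all _ fun x => by positivity)
      (hint.integrableOn.const_mul ((C * A) ^ ((q - 2) / 2) * R ^ e))
      ((ae_restrict_iff' hms).2 (ae_of_all _ hbound))).trans ?_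
    rw [integral_const_mul]
    gcongr
    rw [hA]
    exact setIntegral_le_integral hint (ae_of_all _ fun x => by positivity)
  have hI0 : 0 ≤ ∫ x in {x : EuclideanSpace ℝ (Fin d) | R < ‖x‖}, |u x| ^ q :=
    integral_nonneg fun x => by positivity
  refine (Real.rpow_le_rpow hI0 hInt (by positivity)).trans ?_
  have hexp : e * (1 / q) = -((2 * (d : ℝ) - 3) / 4) * ((q - 2) / q) + 1 / q := by
    rw [he, hk]; field_simp; ring
  have hCA : (C * A) ^ ((q - 2) / 2 * (1 / q)) * A ^ (1 / q)
      = C ^ ((q - 2) / 2 * (1 / q)) * √A := by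
    rw [Real.mul_rpow (by positivity) hA0, mul_assoc,
      ← Real.rpow_add_of_nonneg hA0 (by positivity) (by positivity), Real.sqrt_eq_rpow]
    congr 2; field_simp; ring
  have hCle : C ^ ((q - 2) / 2 * (1 / q)) ≤ C := by
    refine (Real.rpow_le_rpow_of_exponent_le hC1 ?_).trans_eq (Real.rpow_one C)
    rw [mul_one_div, div_le_one hq0]; linarith
  calc ((C * A) ^ ((q - 2) / 2) * R ^ e * A) ^ (1 / q)
      = (C * A) ^ ((q - 2) / 2 * (1 / q)) * A ^ (1 / q) * R ^ (e * (1 / q)) := by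
        rw [Real.mul_rpow (by positivity) hA0, Real.mul_rpow (by positivity) (by positivity),
          ← Real.rpow_mul (by positivity), ← Real.rpow_mul hR.le]
        ring
    _ ≤ C * √A * R ^ (e * (1 / q)) := by rw [hCA]; gcongr
    _ = _ := by rw [hexp]; ring
end

section
/- Let d ≥ 3 be an integer. Suppose u : ℝ^d → ℝ is radial, continuously differentiable on ℝ^d ∖ {0}, and A := ∫_{ℝ^d} (|∇u(x)|² + |u(x)|²/|x|) dx is finite. Then there exists a constant C depending only on d such that ∫_{ℝ^d} |u(x)|^{2+4/(2d-3)} dx ≤ C · A^{2/(2d-3)} · ∫_{ℝ^d} (|u(x)|²/|x|) dx. -/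
open MeasureTheory

/-- Strauss-type pointwise bound in one radial variable: a `C¹` function on the half-line with
finite weighted Coulomb energy decays like `r ^ (-(d - 3/2)/2)`. -/
theorem sq_mul_rpow_le_setIntegral (d : ℕ) (hd : 3 ≤ d) (φ : ℝ → ℝ)
    (hφ : ContDiffOn ℝ 1 φ (Set.Ioi 0))
    (hint : IntegrableOn (fun s : ℝ => s ^ (d - 1) * (deriv φ s ^ 2 + φ s ^ 2 / s)) (Set.Ioi 0))
    {r : ℝ} (hr : 0 < r) :
    φ r ^ 2 * r ^ ((d : ℝ) - 3 / 2) ≤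
      ∫ s in Set.Ioi (0 : ℝ), s ^ (d - 1) * (deriv φ s ^ 2 + φ s ^ 2 / s) := by
  set G : ℝ → ℝ := fun s => s ^ (d - 1) * (deriv φ s ^ 2 + φ s ^ 2 / s) with hG
  set B := ∫ s in Set.Ioi (0 : ℝ), G s with hB
  have hG0 : ∀ s, 0 < s → 0 ≤ G s := fun s hs => by simp only [hG]; positivity
  have hα : (0 : ℝ) ≤ (d : ℝ) - 3 / 2 := by
    have : (3 : ℝ) ≤ d := by exact_mod_cast hd
    linarith
  have hφ' : ContinuousOn (deriv φ) (Set.Ioi 0) :=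
    hφ.continuousOn_deriv_of_isOpen isOpen_Ioi le_rfl
  have hderiv : ∀ s, 0 < s → HasDerivAt φ (deriv φ s) s := fun s hs =>
    ((hφ.differentiableOn one_ne_zero).differentiableAt (Ioi_mem_nhds hs)).hasDerivAt
  have hrα : 0 < r ^ ((d : ℝ) - 3 / 2) := Real.rpow_pos_of_pos hr _
  have hpoint : ∀ s, r ≤ s → -(2 * φ s * deriv φ s) * r ^ ((d : ℝ) - 3 / 2) ≤ G s := by
    intro s hs
    have hs0 : 0 < s := hr.trans_le hs
    have hpow : s ^ (d - 1) = √s * s ^ ((d : ℝ) - 3 / 2) := by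
      rw [Real.sqrt_eq_rpow, ← Real.rpow_add hs0, ← Real.rpow_natCast,
        Nat.cast_sub (by omega : 1 ≤ d)]
      congr 1
      push_cast
      ring
    have hsq : 0 < √s := Real.sqrt_pos.2 hs0
    have hyoung : |2 * φ s * deriv φ s| ≤ √s * (deriv φ s ^ 2 + φ s ^ 2 / s) := by
      have h1 : √s * (deriv φ s ^ 2 + φ s ^ 2 / s) - 2 * |φ s| * |deriv φ s|
          = √s * (|deriv φ s| - |φ s| / √s) ^ 2 := by
        rw [← sq_abs (deriv φ s), ← sq_abs (φ s)]
        have h0 : |φ s| ^ 2 / s = (|φ s| / √s) ^ 2 := by rw [div_pow, Real.sq_sqrt hs0.le]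
        rw [h0]
        field_simp
        ring
      rw [abs_mul, abs_mul, abs_two]
      have h2 : 0 ≤ √s * (|deriv φ s| - |φ s| / √s) ^ 2 := by positivity
      linarith
    calc -(2 * φ s * deriv φ s) * r ^ ((d : ℝ) - 3 / 2)
        ≤ |2 * φ s * deriv φ s| * s ^ ((d : ℝ) - 3 / 2) :=
          mul_le_mul (neg_le_abs _) (Real.rpow_le_rpow hr.le hs hα) hrα.le (abs_nonneg _)
      _ ≤ (√s * (deriv φ s ^ 2 + φ s ^ 2 / s)) * s ^ ((d : ℝ) - 3 / 2) := by gcongr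
      _ = G s := by simp only [hG, hpow]; ring
  have hfar : ∀ R, r ≤ R → (φ r ^ 2 - φ R ^ 2) * r ^ ((d : ℝ) - 3 / 2) ≤ B := by
    intro R hR
    have hsub : Set.Icc r R ⊆ Set.Ioi 0 := fun s hs => hr.trans_le hs.1
    have hcont : ContinuousOn (fun s => 2 * φ s * deriv φ s) (Set.uIcc r R) := by
      rw [Set.uIcc_of_le hR]
      exact (continuousOn_const.mul (hφ.continuousOn.mono hsub)).mul (hφ'.mono hsub)
    have hftc : ∫ s in r..R, 2 * φ s * deriv φ s = φ R ^ 2 - φ r ^ 2 := by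
      refine intervalIntegral.integral_eq_sub_of_hasDerivAt (f := fun s => φ s ^ 2) ?_
        hcont.intervalIntegrable
      intro s hs
      rw [Set.uIcc_of_le hR] at hs
      simpa using (hderiv s (hsub hs)).fun_pow 2
    have hGi : IntervalIntegrable G volume r R := by
      rw [intervalIntegrable_iff_integrableOn_Ioc_of_le hR]
      exact hint.mono_set (Set.Ioc_subset_Icc_self.trans hsub)
    calc (φ r ^ 2 - φ R ^ 2) * r ^ ((d : ℝ) - 3 / 2)
        = ∫ s in r..R, -(2 * φ s * deriv φ s) * r ^ ((d : ℝ) - 3 / 2) := by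
          rw [intervalIntegral.integral_mul_const, intervalIntegral.integral_neg, hftc]
          ring
      _ ≤ ∫ s in r..R, G s :=
          intervalIntegral.integral_mono_on hR (hcont.neg.mul continuousOn_const).intervalIntegrable
            hGi fun s hs => hpoint s hs.1
      _ ≤ B := by
          rw [intervalIntegral.integral_of_le hR]
          exact setIntegral_mono_set hint
            ((ae_restrict_iff' measurableSet_Ioi).2 (.of_forall hG0))
            (Set.Ioc_subset_Icc_self.trans hsub).eventuallyLE
  have hsmall : ∀ ε > 0, ∃ R, r ≤ R ∧ φ R ^ 2 < ε := by
    intro ε hε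
    by_contra! h
    have hconst : IntegrableOn (fun _ : ℝ => r ^ (d - 2) * ε) (Set.Ioi r) := by
      refine (hint.mono_set (Set.Ioi_subset_Ioi hr.le)).mono' aestronglyMeasurable_const ?_
      refine (ae_restrict_iff' measurableSet_Ioi).2 (.of_forall fun s hs => ?_)
      have hs0 : 0 < s := hr.trans hs
      rw [Real.norm_of_nonneg (by positivity)]
      have hpow : s ^ (d - 1) = s ^ (d - 2) * s := by
        rw [← pow_succ]
        congr 1
        omega
      calc r ^ (d - 2) * ε ≤ s ^ (d - 2) * φ s ^ 2 := by
            gcongr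
            · exact (le_of_lt hs)
            · exact h s (le_of_lt hs)
        _ = s ^ (d - 1) * (φ s ^ 2 / s) := by rw [hpow]; field_simp
        _ ≤ s ^ (d - 1) * (deriv φ s ^ 2 + φ s ^ 2 / s) := by
            gcongr
            exact le_add_of_nonneg_left (sq_nonneg _)
    rw [integrableOn_const_iff] at hconst
    rcases hconst with h0 | h0
    · exact (by positivity : r ^ (d - 2) * ε ≠ 0) (by simpa using h0)
    · simp at h0
  refine le_of_forall_pos_le_add fun ε hε => ?_
  obtain ⟨R, hR, hRε⟩ := hsmall (ε / r ^ ((d : ℝ) - 3 / 2)) (by positivity)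
  have h1 := hfar R hR
  rw [lt_div_iff₀ hrα] at hRε
  linarith

/-- The radial derivative of a radial function is bounded by the norm of its gradient. -/
theorem abs_deriv_le_norm_gradient_of_radial {E : Type*} [NormedAddCommGroup E]
    [InnerProductSpace ℝ E] [CompleteSpace E] {u : E → ℝ}
    (hu : ∀ x y : E, ‖x‖ = ‖y‖ → u x = u y) {e x : E} (he : ‖e‖ = 1) (hx : x ≠ 0)
    (hd : DifferentiableAt ℝ u x) :
    |deriv (fun r : ℝ => u (r • e)) ‖x‖| ≤ ‖gradient u x‖ := by
  have hx0 : ‖x‖ ≠ 0 := norm_ne_zero_iff.2 hx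
  set v : E := ‖x‖⁻¹ • x with hv
  have hv1 : ‖v‖ = 1 := by rw [hv, norm_smul, norm_inv, norm_norm, inv_mul_cancel₀ hx0]
  have hxv : ‖x‖ • v = x := by rw [hv, smul_smul, mul_inv_cancel₀ hx0, one_smul]
  have hfun : (fun r : ℝ => u (r • e)) = fun r : ℝ => u (r • v) :=
    funext fun r => hu _ _ (by rw [norm_smul, norm_smul, he, hv1])
  have hline : HasDerivAt (fun r : ℝ => r • v) v ‖x‖ := by
    simpa using (hasDerivAt_id ‖x‖).smul_const v
  have hgrad : HasFDerivAt u (InnerProductSpace.toDual ℝ E (gradient u x)) (‖x‖ • v) := by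
    rw [hxv]
    exact hd.hasGradientAt.hasFDerivAt
  have hcomp := hgrad.comp_hasDerivAt ‖x‖ hline
  have heq : deriv (fun r : ℝ => u (r • e)) ‖x‖ = inner ℝ (gradient u x) v := by
    rw [hfun]
    simpa [Function.comp_def] using hcomp.deriv
  rw [heq]
  simpa [hv1] using abs_real_inner_le_norm (gradient u x) v


/-- Gagliardo–Nirenberg-type inequality for radial `𝓗¹`
functions: for radial `u : ℝ^d → ℝ` (d ≥ 3), `C¹` away from the origin, with
`A = ∫ (|∇u|² + |u|²/|x|) < ∞`, one has
`∫ |u|^{2+4/(2d-3)} ≤ C · A^{2/(2d-3)} · ∫ |u|²/|x|`, with `C = C(d)`. -/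
theorem stmt3 (d : ℕ) (hd : 3 ≤ d) :
    ∃ C : ℝ, 0 < C ∧
      ∀ (u : EuclideanSpace ℝ (Fin d) → ℝ) (A : ℝ),
        (∀ x y : EuclideanSpace ℝ (Fin d), ‖x‖ = ‖y‖ → u x = u y) →
        ContDiffOn ℝ 1 u {(0 : EuclideanSpace ℝ (Fin d))}ᶜ →
        Integrable (fun x : EuclideanSpace ℝ (Fin d) =>
          ‖gradient u x‖ ^ 2 + (u x) ^ 2 / ‖x‖) →
        A = ∫ x : EuclideanSpace ℝ (Fin d), (‖gradient u x‖ ^ 2 + (u x) ^ 2 / ‖x‖) →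
        ∫ x : EuclideanSpace ℝ (Fin d), |u x| ^ (2 + 4 / (2 * (d : ℝ) - 3))
          ≤ C * A ^ (2 / (2 * (d : ℝ) - 3)) *
              ∫ x : EuclideanSpace ℝ (Fin d), (u x) ^ 2 / ‖x‖ := by
  have hd3 : (3 : ℝ) ≤ d := by exact_mod_cast hd
  set p : ℝ := 2 / (2 * (d : ℝ) - 3) with hp
  have hp0 : 0 < p := by rw [hp]; apply div_pos <;> linarith
  have hαp : ((d : ℝ) - 3 / 2) * p = 1 := by
    rw [hp, mul_div_assoc', div_eq_one_iff_eq (by linarith)]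
    ring
  have hexp : 2 + 4 / (2 * (d : ℝ) - 3) = 2 + 2 * p := by rw [hp]; ring
  let e : EuclideanSpace ℝ (Fin d) := EuclideanSpace.single ⟨0, by omega⟩ 1
  have he : ‖e‖ = 1 := by simp [e]
  have : Nontrivial (EuclideanSpace ℝ (Fin d)) :=
    ⟨⟨e, 0, fun h => by simp [h] at he⟩⟩
  set κ : ℝ := d * volume.real (Metric.ball (0 : EuclideanSpace ℝ (Fin d)) 1) with hκ
  have hκ0 : 0 < κ := by
    refine mul_pos (by linarith) ?_
    exact ENNReal.toReal_pos (Metric.measure_ball_pos _ _ one_pos).ne' measure_ball_lt_top.ne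
  refine ⟨κ⁻¹ ^ p, by positivity, fun u A hrad hu hint hA => ?_⟩
  set φ : ℝ → ℝ := fun r => u (r • e) with hφ
  have huφ : ∀ x, u x = φ ‖x‖ := fun x => hrad _ _ (by simp [norm_smul, he])
  have hne : ∀ᵐ x : EuclideanSpace ℝ (Fin d), x ≠ 0 := by
    simp [ae_iff]
  have hmaps : Set.MapsTo (fun r : ℝ => r • e) ({0}ᶜ : Set ℝ) {0}ᶜ := by
    intro r hr h
    have h0 : ‖r • e‖ = 0 := norm_eq_zero.2 h
    rw [norm_smul, he, mul_one, norm_eq_zero] at h0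
    exact hr h0
  have hφc : ContDiffOn ℝ 1 φ {0}ᶜ :=
    hu.comp (contDiff_id.smul contDiff_const).contDiffOn hmaps
  have hφm : Measurable φ := measurable_of_continuousOn_compl_singleton 0 hφc.continuousOn
  set g : ℝ → ℝ := fun s => deriv φ s ^ 2 + φ s ^ 2 / s with hg
  have hgm : Measurable g :=
    ((measurable_deriv φ).pow_const 2).add ((hφm.pow_const 2).div measurable_id)
  have hdom : ∀ᵐ x : EuclideanSpace ℝ (Fin d),
      g ‖x‖ ≤ ‖gradient u x‖ ^ 2 + (u x) ^ 2 / ‖x‖ := by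
    filter_upwards [hne] with x hx
    have hdx : DifferentiableAt ℝ u x :=
      (hu.differentiableOn one_ne_zero).differentiableAt (isOpen_compl_singleton.mem_nhds hx)
    have h := abs_deriv_le_norm_gradient_of_radial hrad he hx hdx
    simp only [hg]
    rw [← huφ x, ← sq_abs (deriv φ ‖x‖)]
    gcongr
  have hg0 : ∀ x : EuclideanSpace ℝ (Fin d), 0 ≤ g ‖x‖ := fun x => by
    simp only [hg]; positivity
  have hgi : Integrable fun x : EuclideanSpace ℝ (Fin d) => g ‖x‖ := by
    refine hint.mono' (hgm.comp measurable_norm).aestronglyMeasurable ?_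
    filter_upwards [hdom] with x hx
    rwa [Real.norm_of_nonneg (hg0 x)]
  have hgA : ∫ x : EuclideanSpace ℝ (Fin d), g ‖x‖ ≤ A := hA ▸ integral_mono_ae hgi hint hdom
  have hui : Integrable fun x : EuclideanSpace ℝ (Fin d) => (u x) ^ 2 / ‖x‖ := by
    refine hgi.mono' ?_ (.of_forall fun x => ?_)
    · simp only [huφ]
      exact (((hφm.comp measurable_norm).pow_const 2).div measurable_norm).aestronglyMeasurable
    · rw [Real.norm_of_nonneg (by positivity), huφ x]
      exact le_add_of_nonneg_left (sq_nonneg _)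
  have hgr : IntegrableOn (fun s : ℝ => s ^ (d - 1) * g s) (Set.Ioi 0) := by
    simpa using (integrable_fun_norm_addHaar (volume : Measure (EuclideanSpace ℝ (Fin d)))).1 hgi
  set B := ∫ s in Set.Ioi (0 : ℝ), s ^ (d - 1) * g s with hB
  have hκB : κ * B ≤ A := by
    have h := integral_fun_norm_addHaar (volume : Measure (EuclideanSpace ℝ (Fin d))) g
    simp only [finrank_euclideanSpace, Fintype.card_fin, nsmul_eq_mul, smul_eq_mul] at h
    rw [hκ, mul_assoc, hB]
    exact h ▸ hgA
  have hBA : B ≤ κ⁻¹ * A := by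
    rw [inv_mul_eq_div, le_div_iff₀ hκ0]
    linarith
  have hA0 : 0 ≤ A := (integral_nonneg hg0).trans hgA
  rw [← integral_const_mul, hexp]
  refine integral_mono_of_nonneg (.of_forall fun x => by positivity) (hui.const_mul _) ?_
  filter_upwards [hne] with x hx
  have hx0 : 0 < ‖x‖ := norm_pos_iff.2 hx
  have hstrauss := sq_mul_rpow_le_setIntegral d hd φ
    (hφc.mono fun s hs => ne_of_gt hs) hgr hx0
  rw [← huφ x] at hstrauss
  have hpow : (u x ^ 2) ^ p * ‖x‖ ≤ κ⁻¹ ^ p * A ^ p := by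
    calc (u x ^ 2) ^ p * ‖x‖ = (u x ^ 2 * ‖x‖ ^ ((d : ℝ) - 3 / 2)) ^ p := by
          rw [Real.mul_rpow (by positivity) (by positivity), ← Real.rpow_mul hx0.le, hαp,
            Real.rpow_one]
      _ ≤ (κ⁻¹ * A) ^ p :=
          Real.rpow_le_rpow (by positivity) (hstrauss.trans hBA) hp0.le
      _ = κ⁻¹ ^ p * A ^ p := Real.mul_rpow (by positivity) hA0
  calc |u x| ^ (2 + 2 * p) = u x ^ 2 * (u x ^ 2) ^ p := by
        rw [Real.rpow_add_of_nonneg (abs_nonneg _) zero_le_two (by positivity),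
          Real.rpow_mul (abs_nonneg _), Real.rpow_two, sq_abs]
    _ = ((u x ^ 2) ^ p * ‖x‖) * (u x ^ 2 / ‖x‖) := by field_simp
    _ ≤ κ⁻¹ ^ p * A ^ p * (u x ^ 2 / ‖x‖) := by gcongr
end

section
/- Let d ≥ 3 be an integer and set λ := (d-1)(d-3)/4. Let u : ℝ^d → ℝ be smooth with compact support contained in ℝ^d ∖ {0}. Then ∫_{ℝ^d} ( |(x/|x|)·∇u(x) + ((d-1)/2)·u(x)/|x||² + λ·|u(x)|²/|x|² ) dx = ∫_{ℝ^d} |(x/|x|)·∇u(x)|² dx, where (x/|x|)·∇u(x) denotes the radial derivative of u at x. -/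
open MeasureTheory

/-- The radial derivative `u_r(x) = (x/|x|) · ∇u(x)`. -/
noncomputable def rderiv {d : ℕ} (u : EuclideanSpace ℝ (Fin d) → ℝ)
    (x : EuclideanSpace ℝ (Fin d)) : ℝ :=
  @inner ℝ _ _ (‖x‖⁻¹ • x) (gradient u x)

theorem rderiv_eq_fderiv {d : ℕ} (u : EuclideanSpace ℝ (Fin d) → ℝ)
    (x : EuclideanSpace ℝ (Fin d)) : rderiv u x = ‖x‖⁻¹ * fderiv ℝ u x x := by
  rw [rderiv, real_inner_comm, gradient, InnerProductSpace.toDual_symm_apply, map_smul,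
    smul_eq_mul]

/-- Dividing by `‖x‖ ^ 2` preserves smoothness for functions supported away from the origin. -/
theorem ContDiff.div_norm_sq_of_zero_notMem_tsupport {E : Type*} [NormedAddCommGroup E]
    [InnerProductSpace ℝ E] {n : WithTop ℕ∞} {h : E → ℝ} (hh : ContDiff ℝ n h)
    (h0 : (0 : E) ∉ tsupport h) : ContDiff ℝ n (fun x ↦ h x / ‖x‖ ^ 2) := by
  rw [contDiff_iff_contDiffAt]
  intro x
  rcases eq_or_ne x 0 with rfl | hx
  · have hev : (fun x ↦ h x / ‖x‖ ^ 2) =ᶠ[nhds 0] fun _ ↦ (0 : ℝ) := by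
      filter_upwards [notMem_tsupport_iff_eventuallyEq.mp h0] with y hy
      simp [hy]
    exact contDiffAt_const.congr_of_eventuallyEq hev
  · exact hh.contDiffAt.div (contDiff_norm_sq ℝ).contDiffAt (by simpa using hx)

/-- The divergence of the vector field `x ↦ g x • x` integrates to zero. -/
theorem integral_fderiv_self_add_mul_eq_zero {d : ℕ} {g : EuclideanSpace ℝ (Fin d) → ℝ}
    (hg : ContDiff ℝ 1 g) (hc : HasCompactSupport g) :
    ∫ x, (fderiv ℝ g x x + d * g x) = 0 := by
  have hg' : Continuous (fderiv ℝ g) := hg.continuous_fderiv one_ne_zero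
  have hc' : HasCompactSupport (fderiv ℝ g) := hc.fderiv ℝ
  let e := EuclideanSpace.basisFun (Fin d) ℝ
  have hcoord (i : Fin d) (x : EuclideanSpace ℝ (Fin d)) :
      HasFDerivAt (fun x ↦ x i) (EuclideanSpace.proj i : EuclideanSpace ℝ (Fin d) →L[ℝ] ℝ) x :=
    (EuclideanSpace.proj i : EuclideanSpace ℝ (Fin d) →L[ℝ] ℝ).hasFDerivAt
  have hint (i : Fin d) : Integrable fun x : EuclideanSpace ℝ (Fin d) ↦
      x i * fderiv ℝ g x (e i) := by
    refine Continuous.integrable_of_hasCompactSupport (by fun_prop) ?_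
    exact hc'.mono' fun x hx ↦ subset_tsupport _ fun h ↦ hx (by simp [h])
  have hgi : Integrable g := hg.continuous.integrable_of_hasCompactSupport hc
  have hparts (i : Fin d) : ∫ x, x i * fderiv ℝ g x (e i) = -∫ x, g x := by
    have hd (x : EuclideanSpace ℝ (Fin d)) :
        fderiv ℝ (fun x : EuclideanSpace ℝ (Fin d) ↦ x i) x (e i) = 1 := by
      rw [(hcoord i x).fderiv]
      simp [e]
    rw [integral_mul_fderiv_eq_neg_fderiv_mul_of_integrable]
    · simp [hd]
    · simpa [hd] using hgi
    · exact hint i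
    · exact Continuous.integrable_of_hasCompactSupport (by fun_prop) hc.mul_left
    · exact fun x _ ↦ (hcoord i x).differentiableAt
    · exact fun x _ ↦ hg.differentiable one_ne_zero x
  have hsum (x : EuclideanSpace ℝ (Fin d)) :
      fderiv ℝ g x x = ∑ i, x i * fderiv ℝ g x (e i) := by
    have h := congrArg (fderiv ℝ g x) (e.sum_repr x)
    rw [map_sum] at h
    rw [← h]
    simp [e]
  simp_rw [hsum]
  rw [integral_add (integrable_finsetSum _ fun i _ ↦ hint i) (hgi.const_mul _),
    integral_finsetSum _ fun i _ ↦ hint i, integral_const_mul]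
  simp [hparts]

theorem fderiv_sq_div_norm_sq_self {d : ℕ} {u : EuclideanSpace ℝ (Fin d) → ℝ}
    {x : EuclideanSpace ℝ (Fin d)} (hu : DifferentiableAt ℝ u x) (hx : x ≠ 0) :
    fderiv ℝ (fun y ↦ u y ^ 2 / ‖y‖ ^ 2) x x
      = 2 * u x * fderiv ℝ u x x / ‖x‖ ^ 2 - 2 * u x ^ 2 / ‖x‖ ^ 2 := by
  have hn : ‖x‖ ≠ 0 := norm_ne_zero_iff.mpr hx
  have hN := (hasStrictFDerivAt_norm_sq x).hasFDerivAt
  have hI := (hasDerivAt_inv (pow_ne_zero 2 hn)).comp_hasFDerivAt x hN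
  have hD := (hu.hasFDerivAt.pow 2).mul hI
  have hE := hD.congr_of_eventuallyEq (f₁ := fun y ↦ u y ^ 2 / ‖y‖ ^ 2)
    (.of_forall fun y ↦ by simp [div_eq_mul_inv])
  rw [hE.fderiv]
  simp
  field_simp
  ring

/-- The identity
`∫ (|Lu|² + λ|u|²/|x|²) = ∫ |u_r|²`, where `Lu = u_r + ((d-1)/2) u/|x|`
and `λ = (d-1)(d-3)/4`, for smooth `u` compactly supported in `ℝ^d ∖ {0}`. -/
theorem stmt4 (d : ℕ) (hd : 3 ≤ d) (u : EuclideanSpace ℝ (Fin d) → ℝ)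
    (hsmooth : ContDiff ℝ (⊤ : ℕ∞) u) (hcompact : HasCompactSupport u)
    (hsupp : (0 : EuclideanSpace ℝ (Fin d)) ∉ tsupport u) :
    ∫ x : EuclideanSpace ℝ (Fin d),
        ((rderiv u x + ((d : ℝ) - 1) / 2 * u x / ‖x‖) ^ 2
          + ((d : ℝ) - 1) * ((d : ℝ) - 3) / 4 * (u x) ^ 2 / ‖x‖ ^ 2)
      = ∫ x : EuclideanSpace ℝ (Fin d), (rderiv u x) ^ 2 := by
  have hu : Differentiable ℝ u := hsmooth.differentiable (by simp)
  have hu' : Continuous (fderiv ℝ u) := hsmooth.continuous_fderiv (by simp)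
  have hsub : tsupport (fun x ↦ u x ^ 2) ⊆ tsupport u :=
    closure_mono fun x hx h ↦ hx (by simp [h])
  have hsub' : tsupport (fun x ↦ (fderiv ℝ u x x) ^ 2) ⊆ tsupport u :=
    closure_minimal (fun x hx ↦ support_fderiv_subset ℝ fun h ↦ hx (by simp [h]))
      (isClosed_tsupport u)
  have hg : ContDiff ℝ 1 fun x ↦ u x ^ 2 / ‖x‖ ^ 2 :=
    ((hsmooth.of_le (by exact_mod_cast le_top)).pow 2).div_norm_sq_of_zero_notMem_tsupport
      fun h ↦ hsupp (hsub h)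
  have hgc : HasCompactSupport fun x ↦ u x ^ 2 / ‖x‖ ^ 2 :=
    hcompact.mono fun x hx h ↦ hx (by simp [h])
  have hr : Integrable fun x ↦ rderiv u x ^ 2 := by
    have heq : (fun x ↦ rderiv u x ^ 2) = fun x ↦ (fderiv ℝ u x x) ^ 2 / ‖x‖ ^ 2 := by
      ext x
      rw [rderiv_eq_fderiv]
      ring
    rw [heq]
    refine Continuous.integrable_of_hasCompactSupport (contDiff_zero.mp
      (ContDiff.div_norm_sq_of_zero_notMem_tsupport (contDiff_zero.mpr (by fun_prop))
        fun h ↦ hsupp (hsub' h))) ?_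
    exact hcompact.mono' fun x hx ↦ hsub' (subset_tsupport _ fun h ↦ hx (by simp [h]))
  have hdiv : Integrable fun x : EuclideanSpace ℝ (Fin d) ↦
      fderiv ℝ (fun y ↦ u y ^ 2 / ‖y‖ ^ 2) x x + d * (u x ^ 2 / ‖x‖ ^ 2) := by
    have hg' := hg.continuous_fderiv one_ne_zero
    refine .add (Continuous.integrable_of_hasCompactSupport (by fun_prop) ?_)
      ((hg.continuous.integrable_of_hasCompactSupport hgc).const_mul _)
    exact (hgc.fderiv ℝ).mono fun x hx h ↦ hx (by simp [h])
  have hpoint (x : EuclideanSpace ℝ (Fin d)) :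
      (rderiv u x + ((d : ℝ) - 1) / 2 * u x / ‖x‖) ^ 2
          + ((d : ℝ) - 1) * ((d : ℝ) - 3) / 4 * (u x) ^ 2 / ‖x‖ ^ 2
        = rderiv u x ^ 2 + ((d : ℝ) - 1) / 2 *
          (fderiv ℝ (fun y ↦ u y ^ 2 / ‖y‖ ^ 2) x x + d * (u x ^ 2 / ‖x‖ ^ 2)) := by
    rcases eq_or_ne x 0 with rfl | hx
    · simp
    · have hn : ‖x‖ ≠ 0 := norm_ne_zero_iff.mpr hx
      rw [fderiv_sq_div_norm_sq_self (hu x) hx, rderiv_eq_fderiv]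
      field_simp
      ring
  simp_rw [hpoint]
  rw [integral_add hr (hdiv.const_mul _), integral_const_mul,
    integral_fderiv_self_add_mul_eq_zero hg hgc, mul_zero, add_zero]
end

section
/- Let μ be a finite nonnegative Borel measure on (0,∞) and let κ ∈ (0,1). Define g : (0,∞) → ℝ by g(x) := ∫_{(x,∞)} y^{-κ} dμ(y). Then (i) g(x) ≤ x^{-κ} · μ((0,∞)) for every x > 0, and (ii) ∫_0^∞ g(x)^{1/κ} dx ≤ μ((0,∞))^{1/κ}, i.e. the L^{1/κ}((0,∞)) norm of g is at most μ((0,∞)). -/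
open MeasureTheory
open scoped ENNReal

theorem lintegral_lintegral_Ioi_mul (μ : Measure ℝ) [SFinite μ] {w h : ℝ → ℝ≥0∞}
    (hw : Measurable w) (hh : Measurable h) :
    ∫⁻ x in Set.Ioi 0, (∫⁻ y in Set.Ioi x, w y ∂μ) * h x =
      ∫⁻ y, w y * (∫⁻ x in Set.Ioo 0 y, h x) ∂μ := by
  have hF : Measurable fun z : ℝ × ℝ => (Set.Ioi z.1).indicator w z.2 * h z.1 := by
    refine Measurable.mul ?_ (hh.comp measurable_fst)
    exact Measurable.ite (measurableSet_lt measurable_fst measurable_snd)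
      (hw.comp measurable_snd) measurable_const
  calc ∫⁻ x in Set.Ioi 0, (∫⁻ y in Set.Ioi x, w y ∂μ) * h x
      = ∫⁻ x in Set.Ioi 0, ∫⁻ y, (Set.Ioi x).indicator w y * h x ∂μ := by
        refine lintegral_congr fun x => ?_
        rw [lintegral_mul_const _ (hw.indicator measurableSet_Ioi),
          lintegral_indicator measurableSet_Ioi]
    _ = ∫⁻ y, (∫⁻ x in Set.Ioi 0, (Set.Ioi x).indicator w y * h x) ∂μ :=
        lintegral_lintegral_swap hF.aemeasurable
    _ = ∫⁻ y, w y * (∫⁻ x in Set.Ioo 0 y, h x) ∂μ := by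
        refine lintegral_congr fun y => ?_
        rw [← lintegral_const_mul _ hh, ← Set.Iio_inter_Ioi,
          ← Measure.restrict_restrict measurableSet_Iio, ← lintegral_indicator measurableSet_Iio]
        refine lintegral_congr fun x => ?_
        by_cases hxy : x < y <;> simp [hxy]

theorem measurable_lintegral_Ioi (μ : Measure ℝ) [SFinite μ] {w : ℝ → ℝ≥0∞}
    (hw : Measurable w) : Measurable fun x => ∫⁻ y in Set.Ioi x, w y ∂μ := by
  simp_rw [← lintegral_indicator measurableSet_Ioi]
  refine Measurable.lintegral_prod_right' (f := fun z : ℝ × ℝ => (Set.Ioi z.1).indicator w z.2) ?_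
  exact Measurable.ite (measurableSet_lt measurable_fst measurable_snd)
    (hw.comp measurable_snd) measurable_const

theorem lintegral_Ioi_rpow_neg_le (μ : Measure ℝ) {κ : ℝ} (hκ0 : 0 < κ) {x : ℝ} (hx : 0 < x) :
    ∫⁻ y in Set.Ioi x, ENNReal.ofReal (y ^ (-κ)) ∂μ ≤
      ENNReal.ofReal (x ^ (-κ)) * μ (Set.Ioi 0) := by
  calc ∫⁻ y in Set.Ioi x, ENNReal.ofReal (y ^ (-κ)) ∂μ
      ≤ ∫⁻ _ in Set.Ioi x, ENNReal.ofReal (x ^ (-κ)) ∂μ :=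
        setLIntegral_mono measurable_const fun y hy => ENNReal.ofReal_le_ofReal <|
          Real.rpow_le_rpow_of_nonpos hx (le_of_lt hy) (by linarith)
    _ = ENNReal.ofReal (x ^ (-κ)) * μ (Set.Ioi x) := by rw [setLIntegral_const]
    _ ≤ _ := by gcongr

theorem lintegral_Ioo_rpow_sub_one {κ y : ℝ} (hκ0 : 0 < κ) (hy : 0 < y) :
    ∫⁻ x in Set.Ioo 0 y, ENNReal.ofReal (x ^ (κ - 1)) = ENNReal.ofReal (y ^ κ / κ) := by
  have hi : IntervalIntegrable (fun x : ℝ => x ^ (κ - 1)) volume 0 y :=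
    intervalIntegral.intervalIntegrable_rpow' (by linarith)
  rw [← setLIntegral_congr Ioo_ae_eq_Ioc.symm, ← ofReal_integral_eq_lintegral_ofReal
    ((intervalIntegrable_iff_integrableOn_Ioc_of_le hy.le).1 hi),
    ← intervalIntegral.integral_of_le hy.le, integral_rpow (Or.inl (by linarith))]
  · simp [Real.zero_rpow hκ0.ne']
  · filter_upwards [ae_restrict_mem measurableSet_Ioc] with x hx
    exact Real.rpow_nonneg hx.1.le _

theorem ENNReal.le_rpow_of_le_mul_rpow_one_sub {I M : ℝ≥0∞} {κ : ℝ} (hκ0 : 0 < κ)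
    (hI : I ≠ ∞) (h : I ≤ M * I ^ (1 - κ)) : I ≤ M ^ (1 / κ) := by
  rcases eq_or_ne I 0 with rfl | h0
  · exact zero_le
  rw [one_div, ENNReal.le_rpow_inv_iff hκ0]
  have hmul : I ^ κ * I ^ (1 - κ) ≤ M * I ^ (1 - κ) := by
    rw [← ENNReal.rpow_add _ _ h0 hI]
    simpa using h
  rwa [ENNReal.mul_le_mul_iff_left (ENNReal.rpow_pos (pos_iff_ne_zero.2 h0) hI).ne'
    (ENNReal.rpow_ne_top_of_ne_zero h0 hI)] at hmul

theorem lintegral_lintegral_Ioi_rpow_neg_rpow_le (μ : Measure ℝ) [IsFiniteMeasure μ]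
    (hμ : μ (Set.Iic 0) = 0) {κ : ℝ} (hκ0 : 0 < κ) (hκ1 : κ < 1) :
    ∫⁻ x in Set.Ioi 0, (∫⁻ y in Set.Ioi x, ENNReal.ofReal (y ^ (-κ)) ∂μ) ^ (1 / κ) ≤
      μ (Set.Ioi 0) ^ (1 / κ) := by
  set w : ℝ → ℝ≥0∞ := fun y => ENNReal.ofReal (y ^ (-κ))
  set G : ℝ → ℝ≥0∞ := fun x => ∫⁻ y in Set.Ioi x, w y ∂μ
  set M := μ (Set.Ioi 0)
  have hw : Measurable w := by fun_prop
  have hG : Measurable G := measurable_lintegral_Ioi μ hw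
  have hp : 0 < 1 / κ - 1 := by
    rw [sub_pos, lt_div_iff₀ hκ0]
    linarith
  have hpos : ∀ᵐ y ∂μ, 0 < y := by
    rw [ae_iff]
    simpa [Set.Iic] using hμ
  have huniv : μ Set.univ = M := measure_congr (by
    filter_upwards [hpos] with y hy
    exact propext ⟨fun _ => hy, fun _ => trivial⟩)
  have hbound : ∀ C : ℝ≥0∞,
      (∀ y, 0 < y → ∫⁻ x in Set.Ioo 0 y, G x ^ (1 / κ - 1) ≤ ENNReal.ofReal (y ^ κ) * C) →
      ∫⁻ x in Set.Ioi 0, G x ^ (1 / κ) ≤ M * C := by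
    intro C hC
    calc ∫⁻ x in Set.Ioi 0, G x ^ (1 / κ)
        = ∫⁻ x in Set.Ioi 0, G x * G x ^ (1 / κ - 1) := by
          refine lintegral_congr fun x => ?_
          conv_rhs => rw [← ENNReal.rpow_one (G x), ← ENNReal.rpow_mul, one_mul,
            ← ENNReal.rpow_add_of_nonneg _ _ zero_le_one hp.le]
          congr 1
          ring
      _ = ∫⁻ y, w y * (∫⁻ x in Set.Ioo 0 y, G x ^ (1 / κ - 1)) ∂μ :=
          lintegral_lintegral_Ioi_mul μ hw (hG.pow_const _)
      _ ≤ ∫⁻ _, C ∂μ := by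
          refine lintegral_mono_ae ?_
          filter_upwards [hpos] with y hy
          calc w y * ∫⁻ x in Set.Ioo 0 y, G x ^ (1 / κ - 1)
              ≤ w y * (ENNReal.ofReal (y ^ κ) * C) := by gcongr; exact hC y hy
            _ = C := by
              rw [← mul_assoc, ← ENNReal.ofReal_mul (Real.rpow_nonneg hy.le _),
                ← Real.rpow_add hy]
              simp
      _ = M * C := by rw [lintegral_const, huniv, mul_comm]
  have hfin : ∫⁻ x in Set.Ioi 0, G x ^ (1 / κ) ≠ ∞ := by
    refine ne_top_of_le_ne_top ?_ (hbound (ENNReal.ofReal (1 / κ) * M ^ (1 / κ - 1)) ?_)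
    · exact ENNReal.mul_ne_top (measure_ne_top _ _) (ENNReal.mul_ne_top ENNReal.ofReal_ne_top
        (ENNReal.rpow_ne_top_of_nonneg hp.le (measure_ne_top _ _)))
    · intro y hy
      calc ∫⁻ x in Set.Ioo 0 y, G x ^ (1 / κ - 1)
          ≤ ∫⁻ x in Set.Ioo 0 y, ENNReal.ofReal (x ^ (κ - 1)) * M ^ (1 / κ - 1) := by
            refine setLIntegral_mono (by fun_prop) fun x hx => ?_
            calc G x ^ (1 / κ - 1) ≤ (w x * M) ^ (1 / κ - 1) :=
                  ENNReal.rpow_le_rpow (lintegral_Ioi_rpow_neg_le μ hκ0 hx.1) hp.le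
              _ = _ := by
                rw [ENNReal.mul_rpow_of_nonneg _ _ hp.le,
                  ENNReal.ofReal_rpow_of_nonneg (Real.rpow_nonneg hx.1.le _) hp.le,
                  ← Real.rpow_mul hx.1.le]
                congr 3
                field_simp
                ring
        _ = _ := by
            rw [lintegral_mul_const _ (by fun_prop), lintegral_Ioo_rpow_sub_one hκ0 hy,
              ← mul_assoc, ← ENNReal.ofReal_mul (Real.rpow_nonneg hy.le _), mul_one_div]
  refine ENNReal.le_rpow_of_le_mul_rpow_one_sub hκ0 hfin (hbound _ fun y hy => ?_)
  have hpq : (1 / (1 - κ)).HolderConjugate (1 / κ) := by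
    rw [Real.holderConjugate_iff]
    exact ⟨by rw [lt_div_iff₀ (by linarith)]; linarith, by simp⟩
  calc ∫⁻ x in Set.Ioo 0 y, G x ^ (1 / κ - 1)
      = ∫⁻ x in Set.Ioo 0 y, ((fun x => G x ^ (1 / κ - 1)) * (fun _ => 1 : ℝ → ℝ≥0∞)) x := by simp
    _ ≤ (∫⁻ x in Set.Ioo 0 y, (G x ^ (1 / κ - 1)) ^ (1 / (1 - κ))) ^ (1 / (1 / (1 - κ))) *
          (∫⁻ _ in Set.Ioo 0 y, 1 ^ (1 / κ)) ^ (1 / (1 / κ)) :=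
        ENNReal.lintegral_mul_le_Lp_mul_Lq _ hpq (hG.pow_const _).aemeasurable
          aemeasurable_const
    _ = (∫⁻ x in Set.Ioo 0 y, G x ^ (1 / κ)) ^ (1 - κ) * ENNReal.ofReal (y ^ κ) := by
        have hexp : (1 / κ - 1) * (1 / (1 - κ)) = 1 / κ := by
          have : 1 - κ ≠ 0 := by linarith
          field_simp
        simp only [← ENNReal.rpow_mul, hexp, one_div_one_div]
        simp [ENNReal.ofReal_rpow_of_nonneg hy.le hκ0.le]
    _ ≤ ENNReal.ofReal (y ^ κ) * (∫⁻ x in Set.Ioi 0, G x ^ (1 / κ)) ^ (1 - κ) := by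
        rw [mul_comm]
        have : 0 ≤ 1 - κ := by linarith
        gcongr
        exact Set.Ioo_subset_Ioi_self

/-- Let `μ` be a finite nonnegative Borel measure on `(0,∞)`
and `κ ∈ (0,1)`. Define `g(x) = ∫_{(x,∞)} y^{-κ} dμ(y)`. Then
`g(x) ≤ x^{-κ} μ((0,∞))` for `x > 0`, and
`∫_0^∞ g(x)^{1/κ} dx ≤ μ((0,∞))^{1/κ}`. -/
theorem stmt5 (μ : Measure ℝ) [IsFiniteMeasure μ] (hμ : μ (Set.Iic 0) = 0)
    (κ : ℝ) (hκ0 : 0 < κ) (hκ1 : κ < 1)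
    (g : ℝ → ℝ) (hg : ∀ x : ℝ, g x = ∫ y in Set.Ioi x, y ^ (-κ) ∂μ) :
    (∀ x : ℝ, 0 < x → g x ≤ x ^ (-κ) * (μ (Set.Ioi 0)).toReal) ∧
      ∫ x in Set.Ioi (0 : ℝ), (g x) ^ (1 / κ)
        ≤ (μ (Set.Ioi 0)).toReal ^ (1 / κ) := by
  have hg_toReal : ∀ x : ℝ, 0 < x →
      g x = (∫⁻ y in Set.Ioi x, ENNReal.ofReal (y ^ (-κ)) ∂μ).toReal := by
    intro x hx
    rw [hg, integral_eq_lintegral_of_nonneg_ae]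
    · filter_upwards [ae_restrict_mem measurableSet_Ioi] with y hy
      exact Real.rpow_nonneg (hx.trans hy).le _
    · exact (by fun_prop : Measurable fun y : ℝ => y ^ (-κ)).aestronglyMeasurable
  refine ⟨fun x hx => ?_, ?_⟩
  · rw [hg_toReal x hx]
    refine (ENNReal.toReal_mono (ENNReal.mul_ne_top ENNReal.ofReal_ne_top (measure_ne_top _ _))
      (lintegral_Ioi_rpow_neg_le μ hκ0 hx)).trans_eq ?_
    rw [ENNReal.toReal_mul, ENNReal.toReal_ofReal (Real.rpow_nonneg hx.le _)]
  · have hp : 0 ≤ 1 / κ := by positivity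
    rw [ENNReal.toReal_rpow]
    refine (le_abs_self _).trans ((norm_integral_le_lintegral_norm fun x => g x ^ (1 / κ)).trans
      (ENNReal.toReal_mono (ENNReal.rpow_ne_top_of_nonneg hp (measure_ne_top _ _))
        (le_trans ?_ (lintegral_lintegral_Ioi_rpow_neg_rpow_le μ hμ hκ0 hκ1))))
    refine setLIntegral_mono' measurableSet_Ioi fun x hx => ?_
    rw [hg_toReal x hx, ENNReal.toReal_rpow, Real.norm_of_nonneg ENNReal.toReal_nonneg]
    exact ENNReal.ofReal_toReal_le
end

section
/- Let φ : ℝ → ℂ be a Schwartz function and let α ∈ (0,1) and N > 0 be real constants. Then there exist constants C > 0 and T > 0 such that for every t ∈ ℝ with |t| ≥ T and every x ∈ ℝ with |x| > |t| - |t|^α, one has |∫_ℝ exp(i(xξ + t·√(ξ²+1))) · φ(ξ) dξ| ≤ C · |t|^{-N}. -/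
open MeasureTheory

namespace KleinGordon

/-- The Japanese bracket `√(ξ² + 1)`. -/
noncomputable def bracket (ξ : ℝ) : ℝ := Real.sqrt (ξ ^ 2 + 1)

lemma bracket_pos (ξ : ℝ) : 0 < bracket ξ := Real.sqrt_pos.2 (by positivity)

lemma bracket_sq (ξ : ℝ) : bracket ξ ^ 2 = ξ ^ 2 + 1 := Real.sq_sqrt (by positivity)

lemma hasDerivAt_bracket (ξ : ℝ) : HasDerivAt bracket (ξ / bracket ξ) ξ := by
  have h : HasDerivAt (fun y : ℝ ↦ y ^ 2 + 1) (2 * ξ) ξ := by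
    simpa using (hasDerivAt_pow 2 ξ).add_const 1
  have hb := (bracket_pos ξ).ne'
  refine (h.sqrt (by positivity)).congr_deriv (Eq.symm ?_)
  change ξ / bracket ξ = 2 * ξ / (2 * bracket ξ)
  field_simp

lemma hasDerivAt_div_bracket (ξ : ℝ) :
    HasDerivAt (fun y ↦ y / bracket y) ((bracket ξ ^ 3)⁻¹) ξ := by
  have hb := (bracket_pos ξ).ne'
  refine ((hasDerivAt_id' ξ).fun_div (hasDerivAt_bracket ξ) hb).congr_deriv ?_
  field_simp
  linear_combination bracket_sq ξ

lemma hasTemperateGrowth_inv_bracket_cube :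
    (fun ξ : ℝ ↦ (bracket ξ ^ 3)⁻¹).HasTemperateGrowth := by
  have h : (fun ξ : ℝ ↦ (bracket ξ ^ 3)⁻¹) = fun ξ ↦ (1 + ‖ξ‖ ^ 2) ^ (-3 / 2 : ℝ) := by
    ext ξ
    rw [Real.norm_eq_abs, sq_abs, add_comm, ← bracket_sq, ← Real.rpow_natCast _ 2,
      ← Real.rpow_mul (bracket_pos ξ).le, ← Real.rpow_natCast _ 3,
      ← Real.rpow_neg (bracket_pos ξ).le]
    norm_num
  rw [h]
  exact Function.hasTemperateGrowth_one_add_norm_sq_rpow ℝ _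

/-- The derivative in `ξ` of the phase `xξ + t√(ξ² + 1)`. -/
noncomputable def phaseDeriv (t x ξ : ℝ) : ℝ := x + t * (ξ / bracket ξ)

lemma hasDerivAt_phase (t x ξ : ℝ) :
    HasDerivAt (fun y ↦ x * y + t * bracket y) (phaseDeriv t x ξ) ξ := by
  simpa [phaseDeriv] using
    ((hasDerivAt_id' ξ).const_mul x).fun_add ((hasDerivAt_bracket ξ).const_mul t)

/-- The oscillating factor `exp (i(xξ + t√(ξ² + 1)))`. -/
noncomputable def wave (t x ξ : ℝ) : ℂ :=
  Complex.exp (Complex.I * ((x * ξ + t * bracket ξ : ℝ) : ℂ))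

lemma norm_wave (t x ξ : ℝ) : ‖wave t x ξ‖ = 1 := by
  rw [wave, mul_comm, Complex.norm_exp_ofReal_mul_I]

lemma hasDerivAt_wave (t x ξ : ℝ) :
    HasDerivAt (wave t x) (wave t x ξ * (Complex.I * phaseDeriv t x ξ)) ξ :=
  ((hasDerivAt_phase t x ξ).ofReal_comp.const_mul Complex.I).cexp

/-- The regularized reciprocal `t / (∂ψ + i)` of the derivative of the phase `ψ`. -/
noncomputable def multiplier (t x ξ : ℝ) : ℂ := t / (phaseDeriv t x ξ + Complex.I)

lemma add_I_ne_zero (p : ℝ) : (p : ℂ) + Complex.I ≠ 0 := by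
  intro h
  simpa using congrArg Complex.im h

lemma phaseDeriv_mul_multiplier (t x ξ : ℝ) :
    phaseDeriv t x ξ * multiplier t x ξ = t - Complex.I * multiplier t x ξ := by
  have := add_I_ne_zero (phaseDeriv t x ξ)
  rw [multiplier]
  field_simp
  ring

lemma hasDerivAt_multiplier (t x ξ : ℝ) :
    HasDerivAt (multiplier t x)
      (-(((bracket ξ ^ 3)⁻¹ : ℝ) : ℂ) * multiplier t x ξ ^ 2) ξ := by
  have hp : HasDerivAt (phaseDeriv t x) (t * (bracket ξ ^ 3)⁻¹) ξ :=
    ((hasDerivAt_div_bracket ξ).const_mul t).const_add x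
  have hne := add_I_ne_zero (phaseDeriv t x ξ)
  refine (((hp.ofReal_comp.add_const Complex.I).fun_inv hne).const_mul (t : ℂ)).congr_deriv ?_
  rw [multiplier]
  push_cast
  field_simp

/-- Outside the region `|x| ≤ |t| - |t|^α`, the multiplier is bounded by a power of the bracket. -/
lemma norm_multiplier_le {α : ℝ} {k : ℕ} (hk : 1 ≤ k * (1 - α))
    {t x : ℝ} (ht : 1 ≤ |t|) (hx : |t| - |t| ^ α < |x|) (ξ : ℝ) :
    ‖multiplier t x ξ‖ ≤ (4 * (ξ ^ 2 + 1)) ^ k := by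
  have ht0 : 0 < |t| := by linarith
  have hk0 : k ≠ 0 := by
    rintro rfl
    norm_num at hk
  have hbase : 1 ≤ 4 * (ξ ^ 2 + 1) := by nlinarith [sq_nonneg ξ]
  have hnorm : ‖multiplier t x ξ‖ = |t| / ‖(phaseDeriv t x ξ : ℂ) + Complex.I‖ := by
    rw [multiplier, norm_div, Complex.norm_real, Real.norm_eq_abs]
  have hre : |phaseDeriv t x ξ| ≤ ‖(phaseDeriv t x ξ : ℂ) + Complex.I‖ := by
    simpa using Complex.abs_re_le_norm ((phaseDeriv t x ξ : ℂ) + Complex.I)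
  have him : 1 ≤ ‖(phaseDeriv t x ξ : ℂ) + Complex.I‖ := by
    simpa using Complex.abs_im_le_norm ((phaseDeriv t x ξ : ℂ) + Complex.I)
  rw [hnorm]
  rcases le_total (4 * (ξ ^ 2 + 1)) (|t| ^ (1 - α)) with h | h
  · refine le_trans ?_ (le_self_pow₀ hbase hk0)
    rw [div_le_iff₀ (by linarith)]
    have hpow : |t| ^ α * (4 * (ξ ^ 2 + 1)) ≤ |t| := by
      calc |t| ^ α * (4 * (ξ ^ 2 + 1)) ≤ |t| ^ α * |t| ^ (1 - α) := by gcongr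
        _ = |t| := by rw [← Real.rpow_add ht0]; simp
    have hb := bracket_pos ξ
    have hgap : 1 ≤ 2 * (ξ ^ 2 + 1) * (1 - |ξ| / bracket ξ) := by
      have h1 : |ξ| / bracket ξ * bracket ξ = |ξ| := by field_simp
      have h2 : (|ξ| / bracket ξ) ^ 2 * (ξ ^ 2 + 1) = ξ ^ 2 := by
        rw [← bracket_sq, ← mul_pow, h1, sq_abs]
      nlinarith [mul_nonneg (sq_nonneg (1 - |ξ| / bracket ξ)) (by positivity : 0 ≤ ξ ^ 2 + 1)]
    have hlow : |x| - |t| * (|ξ| / bracket ξ) ≤ |phaseDeriv t x ξ| := by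
      have := abs_sub_abs_le_abs_sub x (-(t * (ξ / bracket ξ)))
      rw [abs_neg, abs_mul, abs_div, abs_of_pos hb, sub_neg_eq_add] at this
      exact this
    have hlow' : |t| * (1 - |ξ| / bracket ξ) - |t| ^ α
        ≤ ‖(phaseDeriv t x ξ : ℂ) + Complex.I‖ := by linarith
    calc |t| ≤ 4 * (ξ ^ 2 + 1) * (|t| * (1 - |ξ| / bracket ξ) - |t| ^ α) := by
          nlinarith [mul_le_mul_of_nonneg_left hgap ht0.le]
      _ ≤ _ := by gcongr
  · calc |t| / ‖(phaseDeriv t x ξ : ℂ) + Complex.I‖ ≤ |t| := div_le_self ht0.le him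
      _ ≤ |t| ^ (k * (1 - α)) := Real.self_le_rpow_of_one_le ht hk
      _ = (|t| ^ (1 - α)) ^ k := by
        rw [mul_comm, Real.rpow_mul ht0.le, Real.rpow_natCast]
      _ ≤ (4 * (ξ ^ 2 + 1)) ^ k := by gcongr

lemma continuous_amplitude (t x : ℝ) (a : ℕ) (χ : SchwartzMap ℝ ℂ) :
    Continuous fun ξ ↦ wave t x ξ * (multiplier t x ξ ^ a * χ ξ) := by
  have hw : Continuous (wave t x) :=
    continuous_iff_continuousAt.2 fun ξ ↦ (hasDerivAt_wave t x ξ).continuousAt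
  have hm : Continuous (multiplier t x) :=
    continuous_iff_continuousAt.2 fun ξ ↦ (hasDerivAt_multiplier t x ξ).continuousAt
  exact hw.mul ((hm.pow a).mul χ.continuous)

lemma integrable_bound (k a : ℕ) (χ : SchwartzMap ℝ ℂ) :
    Integrable fun ξ : ℝ ↦ ((4 * (ξ ^ 2 + 1)) ^ k) ^ a * ‖χ ξ‖ := by
  have hg : (fun ξ : ℝ ↦ ((4 * (ξ ^ 2 + 1)) ^ k) ^ a).HasTemperateGrowth := by fun_prop
  have hi := (SchwartzMap.smulLeftCLM ℂ
    (fun ξ : ℝ ↦ ((4 * (ξ ^ 2 + 1)) ^ k) ^ a) χ).integrable (μ := volume)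
  refine hi.norm.congr (.of_forall fun ξ ↦ ?_)
  simp only [SchwartzMap.smulLeftCLM_apply_apply hg, norm_smul, Real.norm_eq_abs]
  rw [abs_of_nonneg (by positivity)]

lemma norm_amplitude_le {α : ℝ} {k : ℕ} (hk : 1 ≤ k * (1 - α))
    {t x : ℝ} (ht : 1 ≤ |t|) (hx : |t| - |t| ^ α < |x|) (a : ℕ) (χ : SchwartzMap ℝ ℂ) (ξ : ℝ) :
    ‖wave t x ξ * (multiplier t x ξ ^ a * χ ξ)‖ ≤ ((4 * (ξ ^ 2 + 1)) ^ k) ^ a * ‖χ ξ‖ := by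
  rw [norm_mul, norm_wave, one_mul, norm_mul, norm_pow]
  gcongr
  exact norm_multiplier_le hk ht hx ξ

lemma integrable_amplitude {α : ℝ} {k : ℕ} (hk : 1 ≤ k * (1 - α))
    {t x : ℝ} (ht : 1 ≤ |t|) (hx : |t| - |t| ^ α < |x|) (a : ℕ) (χ : SchwartzMap ℝ ℂ) :
    Integrable fun ξ ↦ wave t x ξ * (multiplier t x ξ ^ a * χ ξ) :=
  (integrable_bound k a χ).mono' (continuous_amplitude t x a χ).aestronglyMeasurable
    (.of_forall (norm_amplitude_le hk ht hx a χ))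

/-- Integration by parts trades a factor `t` for amplitudes of the same kind. -/
lemma mul_integral_amplitude {α : ℝ} {k : ℕ} (hk : 1 ≤ k * (1 - α))
    {t x : ℝ} (ht : 1 ≤ |t|) (hx : |t| - |t| ^ α < |x|) (a : ℕ) (χ : SchwartzMap ℝ ℂ) :
    Complex.I * t * ∫ ξ, wave t x ξ * (multiplier t x ξ ^ a * χ ξ) =
      (a + 1) * (∫ ξ, wave t x ξ * (multiplier t x ξ ^ (a + 2) *
        SchwartzMap.smulLeftCLM ℂ (fun ξ : ℝ ↦ (bracket ξ ^ 3)⁻¹) χ ξ))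
      - (∫ ξ, wave t x ξ * (multiplier t x ξ ^ (a + 1) * χ ξ))
      - ∫ ξ, wave t x ξ * (multiplier t x ξ ^ (a + 1) * SchwartzMap.derivCLM ℝ ℂ χ ξ) := by
  have hint := fun b η ↦ integrable_amplitude hk ht hx b η
  have hderiv : ∀ ξ, HasDerivAt (fun ξ ↦ wave t x ξ * (multiplier t x ξ ^ (a + 1) * χ ξ))
      (Complex.I * t * (wave t x ξ * (multiplier t x ξ ^ a * χ ξ)) +
        wave t x ξ * (multiplier t x ξ ^ (a + 1) * χ ξ) +
        wave t x ξ * (multiplier t x ξ ^ (a + 1) * SchwartzMap.derivCLM ℝ ℂ χ ξ) -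
        (a + 1) * (wave t x ξ * (multiplier t x ξ ^ (a + 2) *
          SchwartzMap.smulLeftCLM ℂ (fun ξ : ℝ ↦ (bracket ξ ^ 3)⁻¹) χ ξ))) ξ := by
    intro ξ
    refine ((hasDerivAt_wave t x ξ).fun_mul (((hasDerivAt_multiplier t x ξ).fun_pow
      (a + 1)).fun_mul χ.differentiableAt.hasDerivAt)).congr_deriv (Eq.symm ?_)
    rw [SchwartzMap.smulLeftCLM_apply_apply hasTemperateGrowth_inv_bracket_cube,
      SchwartzMap.derivCLM_apply, Complex.real_smul]
    simp only [Nat.add_sub_cancel]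
    push_cast
    linear_combination (-Complex.I * wave t x ξ * multiplier t x ξ ^ a * χ ξ) *
      phaseDeriv_mul_multiplier t x ξ
      + wave t x ξ * multiplier t x ξ ^ (a + 1) * χ ξ * Complex.I_sq
  have hI := (hint a χ).const_mul (Complex.I * t)
  have hI' := hI.fun_add (hint (a + 1) χ)
  have hadd := hI'.fun_add (hint (a + 1) (SchwartzMap.derivCLM ℝ ℂ χ))
  have hsub := (hint (a + 2) (SchwartzMap.smulLeftCLM ℂ
    (fun ξ : ℝ ↦ (bracket ξ ^ 3)⁻¹) χ)).const_mul (a + 1 : ℂ)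
  have h := integral_eq_zero_of_hasDerivAt_of_integrable hderiv (hadd.sub hsub) (hint (a + 1) χ)
  rw [integral_sub hadd hsub, integral_add hI' (hint (a + 1) _),
    integral_add hI (hint (a + 1) χ), integral_const_mul, integral_const_mul] at h
  linear_combination h

/-- Rapid decay of the oscillatory integrals with amplitudes `multiplier ^ a * χ`. -/
lemma exists_pow_mul_norm_integral_le {α : ℝ} (hα1 : α < 1) (n a : ℕ) (χ : SchwartzMap ℝ ℂ) :
    ∃ C : ℝ, ∀ t x : ℝ, 1 ≤ |t| → |t| - |t| ^ α < |x| →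
      |t| ^ n * ‖∫ ξ, wave t x ξ * (multiplier t x ξ ^ a * χ ξ)‖ ≤ C := by
  obtain ⟨k, hk⟩ := exists_nat_ge (1 / (1 - α))
  rw [div_le_iff₀ (by linarith)] at hk
  induction n generalizing a χ with
  | zero =>
    refine ⟨∫ ξ : ℝ, ((4 * (ξ ^ 2 + 1)) ^ k) ^ a * ‖χ ξ‖, fun t x ht hx ↦ ?_⟩
    rw [pow_zero, one_mul]
    exact norm_integral_le_of_norm_le (integrable_bound k a χ)
      (.of_forall (norm_amplitude_le hk ht hx a χ))
  | succ n ih =>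
    obtain ⟨C₁, h₁⟩ := ih (a + 2) (SchwartzMap.smulLeftCLM ℂ (fun ξ : ℝ ↦ (bracket ξ ^ 3)⁻¹) χ)
    obtain ⟨C₂, h₂⟩ := ih (a + 1) χ
    obtain ⟨C₃, h₃⟩ := ih (a + 1) (SchwartzMap.derivCLM ℝ ℂ χ)
    refine ⟨(a + 1) * C₁ + C₂ + C₃, fun t x ht hx ↦ ?_⟩
    specialize h₁ t x ht hx
    specialize h₂ t x ht hx
    specialize h₃ t x ht hx
    have h := congrArg norm (mul_integral_amplitude hk ht hx a χ)
    rw [norm_mul, norm_mul, Complex.norm_I, one_mul, Complex.norm_real, Real.norm_eq_abs] at h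
    rw [pow_succ, mul_assoc, h]
    have hcast : ‖(a + 1 : ℂ)‖ = a + 1 := by exact_mod_cast Complex.norm_natCast (a + 1)
    generalize (∫ ξ, wave t x ξ * (multiplier t x ξ ^ (a + 2) * _)) = z₁ at *
    generalize (∫ ξ, wave t x ξ * (multiplier t x ξ ^ (a + 1) * χ ξ)) = z₂ at *
    generalize (∫ ξ, wave t x ξ * (multiplier t x ξ ^ (a + 1) * _)) = z₃ at *
    have htri : ‖(a + 1) * z₁ - z₂ - z₃‖ ≤ (a + 1) * ‖z₁‖ + ‖z₂‖ + ‖z₃‖ := by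
      refine (norm_sub_le _ _).trans (add_le_add_left ((norm_sub_le _ _).trans_eq ?_) _)
      rw [norm_mul, hcast]
    calc |t| ^ n * ‖(a + 1) * z₁ - z₂ - z₃‖
        ≤ |t| ^ n * ((a + 1) * ‖z₁‖ + ‖z₂‖ + ‖z₃‖) := by gcongr
      _ = (a + 1) * (|t| ^ n * ‖z₁‖) + |t| ^ n * ‖z₂‖ + |t| ^ n * ‖z₃‖ := by ring
      _ ≤ (a + 1) * C₁ + C₂ + C₃ := by gcongr

end KleinGordon

/-- Rapid decay, outside the region `|x| ≤ |t| - |t|^α`, of the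
Klein–Gordon oscillatory integral `∫ e^{i(xξ + t√(ξ²+1))} φ(ξ) dξ` for a
Schwartz function `φ`: for any `N > 0` it is `O(|t|^{-N})` there. -/
theorem stmt6 (φ : SchwartzMap ℝ ℂ) (α N : ℝ) (hα0 : 0 < α) (hα1 : α < 1)
    (hN : 0 < N) :
    ∃ C : ℝ, 0 < C ∧ ∃ T : ℝ, 0 < T ∧
      ∀ t x : ℝ, T ≤ |t| → |t| - |t| ^ α < |x| →
        ‖∫ ξ : ℝ, Complex.exp (Complex.I *
            ((x * ξ + t * Real.sqrt (ξ ^ 2 + 1) : ℝ) : ℂ)) * φ ξ‖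
          ≤ C * |t| ^ (-N) := by
  obtain ⟨n, hn⟩ := exists_nat_ge N
  obtain ⟨C, hC⟩ := KleinGordon.exists_pow_mul_norm_integral_le hα1 n 0 φ
  refine ⟨max C 1, by positivity, 1, one_pos, fun t x ht hx ↦ ?_⟩
  have ht0 : 0 < |t| := by linarith
  have h := hC t x ht hx
  simp only [pow_zero, one_mul] at h
  change ‖∫ ξ, KleinGordon.wave t x ξ * φ ξ‖ ≤ _
  rw [Real.rpow_neg ht0.le, ← div_eq_mul_inv, le_div_iff₀ (by positivity), mul_comm]
  calc |t| ^ N * ‖∫ ξ, KleinGordon.wave t x ξ * φ ξ‖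
      ≤ |t| ^ n * ‖∫ ξ, KleinGordon.wave t x ξ * φ ξ‖ := by
        gcongr
        rw [← Real.rpow_natCast]
        exact Real.rpow_le_rpow_of_exponent_le ht hn
    _ ≤ max C 1 := h.trans (le_max_left _ _)
end

section
/- The power series Φ(r) := Σ_{k=1}^∞ r^k / (k·((k-1)!)²) converges for every real r. On (0,∞) the function Φ is positive, strictly increasing, twice differentiable, and satisfies the differential equation Φ''(r) = Φ(r)/r for all r > 0, as well as the inequality Φ'(r) ≤ Φ(r) + 1 for all r > 0. -/
open MeasureTheory

/-- `Φ(r) = Σ_{k≥1} r^k/(k·((k-1)!)²)`, reindexed as a sum over `k : ℕ` of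
`r^{k+1}/((k+1)·(k!)²)`. -/
noncomputable def Phi (r : ℝ) : ℝ :=
  ∑' k : ℕ, r ^ (k + 1) / (((k : ℝ) + 1) * ((Nat.factorial k : ℝ)) ^ 2)

/-- Termwise differentiation of a power series without constant term whose differentiated
coefficients are dominated by those of the exponential. -/
theorem hasDerivAt_tsum_mul_pow_succ {c : ℕ → ℝ}
    (hc : ∀ k, |c k * ((k : ℝ) + 1)| ≤ 1 / (Nat.factorial k : ℝ)) (r : ℝ) :
    HasDerivAt (fun x : ℝ => ∑' k, c k * x ^ (k + 1))
      (∑' k, c k * ((k : ℝ) + 1) * r ^ k) r := by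
  have hr : r ∈ Metric.ball (0 : ℝ) (|r| + 1) := by
    rw [mem_ball_zero_iff, Real.norm_eq_abs]; linarith
  refine hasDerivAt_tsum_of_isPreconnected (u := fun k => (|r| + 1) ^ k / (Nat.factorial k : ℝ))
    (t := Metric.ball (0 : ℝ) (|r| + 1)) (y₀ := 0)
    (g := fun k x => c k * x ^ (k + 1)) (g' := fun k x => c k * ((k : ℝ) + 1) * x ^ k)
    (Real.summable_pow_div_factorial _) Metric.isOpen_ball
    (convex_ball _ _).isPreconnected ?_ ?_ ?_ ?_ hr
  · intro k x _
    simpa [mul_assoc] using (hasDerivAt_pow (k + 1) x).const_mul (c k)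
  · intro k x hx
    rw [mem_ball_zero_iff] at hx
    rw [norm_mul, norm_pow, Real.norm_eq_abs, div_eq_inv_mul, ← one_div]
    exact mul_le_mul (hc k) (pow_le_pow_left₀ (norm_nonneg x) hx.le k) (by positivity)
      (by positivity)
  · exact Metric.mem_ball_self (by positivity)
  · simp

theorem summable_mul_pow_of_abs_le_inv_factorial {c : ℕ → ℝ}
    (hc : ∀ k, |c k| ≤ 1 / (Nat.factorial k : ℝ)) (r : ℝ) :
    Summable fun k => c k * r ^ k := by
  refine Summable.of_norm_bounded (Real.summable_pow_div_factorial |r|) fun k => ?_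
  rw [norm_mul, norm_pow, Real.norm_eq_abs, Real.norm_eq_abs, div_eq_inv_mul, ← one_div]
  exact mul_le_mul_of_nonneg_right (hc k) (by positivity)

theorem one_div_succ_mul_factorial_sq_le (k : ℕ) :
    1 / (((k : ℝ) + 1) * (Nat.factorial k : ℝ) ^ 2) ≤ 1 / (Nat.factorial k : ℝ) := by
  have h : (1 : ℝ) ≤ Nat.factorial k := by exact_mod_cast Nat.factorial_pos k
  have hk : (0 : ℝ) ≤ k := k.cast_nonneg
  apply one_div_le_one_div_of_le (by positivity)
  nlinarith [mul_nonneg hk (sq_nonneg (Nat.factorial k : ℝ))]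

theorem one_div_factorial_sq_le (k : ℕ) :
    1 / (Nat.factorial k : ℝ) ^ 2 ≤ 1 / (Nat.factorial k : ℝ) := by
  have h : (1 : ℝ) ≤ Nat.factorial k := by exact_mod_cast Nat.factorial_pos k
  apply one_div_le_one_div_of_le (by positivity)
  nlinarith

theorem summable_Phi_div (r : ℝ) :
    Summable fun k : ℕ => 1 / (((k : ℝ) + 1) * (Nat.factorial k : ℝ) ^ 2) * r ^ k :=
  summable_mul_pow_of_abs_le_inv_factorial (fun k => by
    rw [abs_of_nonneg (by positivity)]; exact one_div_succ_mul_factorial_sq_le k) r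

theorem summable_Phi (r : ℝ) :
    Summable fun k : ℕ => r ^ (k + 1) / (((k : ℝ) + 1) * (Nat.factorial k : ℝ) ^ 2) :=
  ((summable_Phi_div r).mul_left r).congr fun k => by ring

theorem summable_one_div_factorial_sq_mul_pow (r : ℝ) :
    Summable fun k : ℕ => 1 / (Nat.factorial k : ℝ) ^ 2 * r ^ k :=
  summable_mul_pow_of_abs_le_inv_factorial (fun k => by
    rw [abs_of_nonneg (by positivity)]; exact one_div_factorial_sq_le k) r

theorem tsum_one_div_factorial_sq_mul_pow (r : ℝ) :
    ∑' k : ℕ, 1 / (Nat.factorial k : ℝ) ^ 2 * r ^ k =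
      1 + ∑' k : ℕ, 1 / (Nat.factorial (k + 1) : ℝ) ^ 2 * r ^ (k + 1) := by
  rw [(summable_one_div_factorial_sq_mul_pow r).tsum_eq_zero_add]
  simp

theorem hasDerivAt_Phi (r : ℝ) :
    HasDerivAt Phi (∑' k : ℕ, 1 / (Nat.factorial k : ℝ) ^ 2 * r ^ k) r := by
  have hmul (k : ℕ) : 1 / (((k : ℝ) + 1) * (Nat.factorial k : ℝ) ^ 2) * ((k : ℝ) + 1) =
      1 / (Nat.factorial k : ℝ) ^ 2 := by
    field_simp
  have h := hasDerivAt_tsum_mul_pow_succ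
    (c := fun k => 1 / (((k : ℝ) + 1) * (Nat.factorial k : ℝ) ^ 2)) (fun k => by
      rw [hmul, abs_of_nonneg (by positivity)]; exact one_div_factorial_sq_le k) r
  simp only [hmul] at h
  refine h.congr_of_eventuallyEq (.of_forall fun x => tsum_congr fun k => ?_)
  ring

theorem hasDerivAt_deriv_Phi {r : ℝ} (hr : r ≠ 0) :
    HasDerivAt (deriv Phi) (Phi r / r) r := by
  have hmul (k : ℕ) : 1 / (Nat.factorial (k + 1) : ℝ) ^ 2 * ((k : ℝ) + 1) =
      1 / (((k : ℝ) + 1) * (Nat.factorial k : ℝ) ^ 2) := by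
    rw [Nat.factorial_succ]
    push_cast
    field_simp
  have h := (hasDerivAt_tsum_mul_pow_succ
    (c := fun k => 1 / (Nat.factorial (k + 1) : ℝ) ^ 2) (fun k => by
      rw [hmul, abs_of_nonneg (by positivity)]
      exact one_div_succ_mul_factorial_sq_le k) r).const_add 1
  simp only [hmul] at h
  have hPhi : Phi r / r =
      ∑' k : ℕ, 1 / (((k : ℝ) + 1) * (Nat.factorial k : ℝ) ^ 2) * r ^ k := by
    rw [Phi, ← tsum_div_const]
    refine tsum_congr fun k => ?_
    field_simp
    ring
  rw [hPhi]
  refine h.congr_of_eventuallyEq (.of_forall fun x => ?_)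
  rw [(hasDerivAt_Phi x).deriv, tsum_one_div_factorial_sq_mul_pow]

theorem Phi_pos {r : ℝ} (hr : 0 < r) : 0 < Phi r :=
  (summable_Phi r).tsum_pos (fun k => by positivity) 0 (by positivity)

theorem deriv_Phi_pos {r : ℝ} (hr : 0 < r) : 0 < deriv Phi r := by
  rw [(hasDerivAt_Phi r).deriv]
  exact (summable_one_div_factorial_sq_mul_pow r).tsum_pos (fun k => by positivity) 0
    (by positivity)

theorem deriv_Phi_le {r : ℝ} (hr : 0 ≤ r) : deriv Phi r ≤ Phi r + 1 := by
  rw [(hasDerivAt_Phi r).deriv, tsum_one_div_factorial_sq_mul_pow, add_comm]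
  gcongr
  refine ((summable_nat_add_iff 1).2 (summable_one_div_factorial_sq_mul_pow r)).tsum_le_tsum
    (fun k => ?_) (summable_Phi r)
  rw [one_div_mul_eq_div, Nat.factorial_succ]
  push_cast
  have hk : (0 : ℝ) ≤ k := k.cast_nonneg
  rw [mul_pow]
  gcongr
  nlinarith

/-- The series defining `Φ` converges everywhere; on `(0,∞)`,
`Φ` is positive, strictly increasing, twice differentiable and solves
`Φ'' = Φ/r`, with `Φ' ≤ Φ + 1`. -/
theorem stmt8 :
    (∀ r : ℝ, Summable (fun k : ℕ =>
        r ^ (k + 1) / (((k : ℝ) + 1) * ((Nat.factorial k : ℝ)) ^ 2))) ∧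
    (∀ r ∈ Set.Ioi (0 : ℝ), 0 < Phi r) ∧
    StrictMonoOn Phi (Set.Ioi 0) ∧
    (∀ r ∈ Set.Ioi (0 : ℝ),
      DifferentiableAt ℝ Phi r ∧ DifferentiableAt ℝ (deriv Phi) r ∧
        deriv (deriv Phi) r = Phi r / r ∧ deriv Phi r ≤ Phi r + 1) := by
  refine ⟨summable_Phi, fun r hr => Phi_pos hr, ?_, fun r hr => ?_⟩
  · refine strictMonoOn_of_deriv_pos (convex_Ioi 0)
      (fun r _ => (hasDerivAt_Phi r).continuousAt.continuousWithinAt) fun r hr => ?_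
    rw [interior_Ioi] at hr
    exact deriv_Phi_pos hr
  · have h := hasDerivAt_deriv_Phi (ne_of_gt (Set.mem_Ioi.1 hr))
    exact ⟨(hasDerivAt_Phi r).differentiableAt, h.differentiableAt, h.deriv,
      deriv_Phi_le (le_of_lt hr)⟩
end

section
/- Let f : ℝ³ → ℝ be radial, smooth, with compact support contained in ℝ³ ∖ {0}. Then there exists a radial function u : ℝ³ → ℝ that is continuous on ℝ³, smooth on ℝ³ ∖ {0}, satisfies -Δu(x) + u(x)/|x| = f(x) for every x ≠ 0, has ∫_{ℝ³}(|u(x)|² + |∇u(x)|²) dx < ∞, and satisfies: for every N > 0 there is a constant C > 0 with |u(x)| ≤ C·|x|^{-N} for all |x| ≥ 1. -/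
open MeasureTheory

/-- The Laplacian of `u : ℝ^d → ℝ`, as the sum of second derivatives in the
coordinate directions. -/
noncomputable def lap {d : ℕ} (u : EuclideanSpace ℝ (Fin d) → ℝ)
    (x : EuclideanSpace ℝ (Fin d)) : ℝ :=
  ∑ i : Fin d, iteratedFDeriv ℝ 2 u x ![EuclideanSpace.single i 1, EuclideanSpace.single i 1]

/-- The entire function `x ↦ ∑ xⁿ / (n! (n + k)!)`, a rescaled modified Bessel function of order
`k`. -/
noncomputable def besselSeries (k : ℕ) (x : ℝ) : ℝ :=
  ∑' n : ℕ, x ^ n / ((n.factorial : ℝ) * (n + k).factorial)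

namespace besselSeries

theorem summable (k : ℕ) (x : ℝ) :
    Summable fun n : ℕ => x ^ n / ((n.factorial : ℝ) * (n + k).factorial) := by
  refine .of_norm_bounded (Real.summable_pow_div_factorial |x|) fun n => ?_
  have h : (1 : ℝ) ≤ (n + k).factorial := by exact_mod_cast (n + k).factorial_pos
  have h' : (0 : ℝ) < n.factorial := by exact_mod_cast n.factorial_pos
  rw [norm_div, norm_pow, Real.norm_eq_abs, Real.norm_of_nonneg (by positivity)]
  gcongr
  nlinarith

theorem deriv_term_succ (k n : ℕ) (x : ℝ) :
    ((n + 1 : ℕ) : ℝ) * x ^ n / (((n + 1).factorial : ℝ) * (n + 1 + k).factorial) =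
      x ^ n / ((n.factorial : ℝ) * (n + (k + 1)).factorial) := by
  have h : (0 : ℝ) < (n + (k + 1)).factorial := by exact_mod_cast Nat.factorial_pos _
  have h' : (0 : ℝ) < n.factorial := by exact_mod_cast n.factorial_pos
  rw [show n + 1 + k = n + (k + 1) by ring, Nat.factorial_succ n]
  push_cast
  field_simp

theorem hasDerivAt (k : ℕ) (x : ℝ) :
    HasDerivAt (besselSeries k) (besselSeries (k + 1) x) x := by
  have hsum (R : ℝ) : Summable fun n : ℕ =>
      (n : ℝ) * R ^ (n - 1) / ((n.factorial : ℝ) * (n + k).factorial) := by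
    rw [← summable_nat_add_iff 1]
    simpa only [Nat.add_sub_cancel, deriv_term_succ] using summable (k + 1) R
  have key := hasDerivAt_tsum_of_isPreconnected (t := Metric.ball (0 : ℝ) (|x| + 1)) (y := x)
    (y₀ := x) (g := fun (n : ℕ) (y : ℝ) => y ^ n / ((n.factorial : ℝ) * (n + k).factorial))
    (g' := fun (n : ℕ) (y : ℝ) =>
      (n : ℝ) * y ^ (n - 1) / ((n.factorial : ℝ) * (n + k).factorial))
    (hsum (|x| + 1)) Metric.isOpen_ball (convex_ball _ _).isPreconnected
    (fun n y _ => (hasDerivAt_pow n y).div_const _) (fun n y hy => by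
      rw [mem_ball_zero_iff, Real.norm_eq_abs] at hy
      rw [norm_div, norm_mul, norm_pow, Real.norm_of_nonneg (Nat.cast_nonneg n),
        Real.norm_eq_abs, Real.norm_of_nonneg (by positivity)]
      gcongr) (by simp) (summable k x) (by simp)
  rw [(hsum x).tsum_eq_zero_add] at key
  simp only [Nat.add_sub_cancel, deriv_term_succ, Nat.cast_zero, zero_mul, zero_div, zero_add]
    at key
  exact key

theorem contDiff (k : ℕ) : ContDiff ℝ (⊤ : ℕ∞) (besselSeries k) := by
  refine contDiff_infty.2 fun m => ?_
  induction m generalizing k with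
  | zero =>
    have h : Continuous (besselSeries k) :=
      continuous_iff_continuousAt.2 fun x => (hasDerivAt k x).continuousAt
    simpa using h
  | succ m ih =>
    rw [Nat.cast_add, Nat.cast_one, contDiff_succ_iff_deriv]
    refine ⟨fun x => (hasDerivAt k x).differentiableAt, by simp, ?_⟩
    rw [funext fun x => (hasDerivAt k x).deriv]
    exact ih (k + 1)

theorem recurrence (k : ℕ) (x : ℝ) :
    x * besselSeries (k + 2) x + (k + 1) * besselSeries (k + 1) x = besselSeries k x := by
  have h1 : (x * besselSeries (k + 2) x) =
      ∑' n : ℕ, n * (x ^ n / ((n.factorial : ℝ) * (n + (k + 1)).factorial)) := by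
    have hterm (n : ℕ) : ((n + 1 : ℕ) : ℝ) *
        (x ^ (n + 1) / (((n + 1).factorial : ℝ) * (n + 1 + (k + 1)).factorial)) =
          x * (x ^ n / ((n.factorial : ℝ) * (n + (k + 2)).factorial)) := by
      rw [← deriv_term_succ (k + 1) n x]
      ring
    rw [Summable.tsum_eq_zero_add]
    · simp only [hterm, Nat.cast_zero, zero_mul, zero_add, tsum_mul_left, besselSeries]
    · rw [← summable_nat_add_iff 1]
      simpa only [hterm] using (summable (k + 2) x).mul_left x
  have hs : Summable fun n : ℕ =>
      n * (x ^ n / ((n.factorial : ℝ) * (n + (k + 1)).factorial)) := by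
    refine (((summable k x).sub ((summable (k + 1) x).mul_left (k + 1 : ℝ)))).congr fun n => ?_
    have h : (0 : ℝ) < (n + k).factorial := by exact_mod_cast Nat.factorial_pos _
    have h' : (0 : ℝ) < n.factorial := by exact_mod_cast n.factorial_pos
    rw [← add_assoc, Nat.factorial_succ (n + k)]
    push_cast
    field_simp
    ring
  rw [h1, besselSeries, besselSeries, ← tsum_mul_left,
    ← hs.tsum_add ((summable (k + 1) x).mul_left _)]
  refine tsum_congr fun n => ?_
  have h : (0 : ℝ) < (n + k).factorial := by exact_mod_cast Nat.factorial_pos _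
  have h' : (0 : ℝ) < n.factorial := by exact_mod_cast n.factorial_pos
  rw [← add_assoc, Nat.factorial_succ (n + k)]
  push_cast
  field_simp
  ring

theorem term_le (k n : ℕ) {x : ℝ} (hx : 0 ≤ x) :
    x ^ n / ((n.factorial : ℝ) * (n + k).factorial) ≤ besselSeries k x :=
  (summable k x).le_tsum n fun _ _ => by positivity

theorem pos (k : ℕ) {x : ℝ} (hx : 0 ≤ x) : 0 < besselSeries k x :=
  lt_of_lt_of_le (by positivity) (term_le k 0 hx)

theorem succ_le (k : ℕ) {x : ℝ} (hx : 0 ≤ x) : besselSeries (k + 1) x ≤ besselSeries k x := by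
  refine (summable (k + 1) x).tsum_le_tsum (fun n => ?_) (summable k x)
  gcongr
  omega

theorem monotoneOn (k : ℕ) : MonotoneOn (besselSeries k) (Set.Ici 0) := by
  intro x hx y _ hxy
  refine (summable k x).tsum_le_tsum (fun n => ?_) (summable k y)
  have : (0 : ℝ) ≤ x := hx
  gcongr

end besselSeries

section Radial

variable {E : Type*} [NormedAddCommGroup E] [InnerProductSpace ℝ E]

theorem HasDerivAt.hasFDerivAt_comp_norm {U : ℝ → ℝ} {U' : ℝ} {x : E} (hx : x ≠ 0)
    (h : HasDerivAt U U' ‖x‖) :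
    HasFDerivAt (fun y => U ‖y‖) ((U' / ‖x‖) • innerSL ℝ x) x := by
  have hn : HasFDerivAt (fun y : E => ‖y‖) (‖x‖⁻¹ • innerSL ℝ x) x := by
    have h1 := (hasStrictFDerivAt_norm_sq x).hasFDerivAt.sqrt (by positivity)
    simp only [Real.sqrt_sq (norm_nonneg _)] at h1
    refine h1.congr_fderiv ?_
    ext v
    simp
    field_simp
  refine (h.comp_hasFDerivAt x hn).congr_fderiv ?_
  rw [smul_smul, div_eq_mul_inv]

theorem norm_fderiv_comp_norm {U : ℝ → ℝ} {U' : ℝ} {x : E} (hx : x ≠ 0)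
    (h : HasDerivAt U U' ‖x‖) : ‖fderiv ℝ (fun y : E => U ‖y‖) x‖ = |U'| := by
  have hx' : ‖x‖ ≠ 0 := norm_ne_zero_iff.2 hx
  rw [(h.hasFDerivAt_comp_norm hx).fderiv, norm_smul, innerSL_apply_norm, Real.norm_eq_abs,
    abs_div, abs_norm, div_mul_cancel₀ _ hx']

theorem lap_comp_norm {d : ℕ} {U U' : ℝ → ℝ} {U'' : ℝ} {x : EuclideanSpace ℝ (Fin d)}
    (hx : x ≠ 0) (hU : ∀ r, 0 < r → HasDerivAt U (U' r) r) (hU' : HasDerivAt U' U'' ‖x‖) :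
    lap (fun y => U ‖y‖) x = U'' + (d - 1) * U' ‖x‖ / ‖x‖ := by
  have hx' : ‖x‖ ≠ 0 := norm_ne_zero_iff.2 hx
  let B : EuclideanSpace ℝ (Fin d) →L[ℝ] EuclideanSpace ℝ (Fin d) →L[ℝ] ℝ := innerSL ℝ
  have hB (v w : EuclideanSpace ℝ (Fin d)) : B v w = inner ℝ v w := innerSL_apply_apply ℝ v w
  have hev : fderiv ℝ (fun y : EuclideanSpace ℝ (Fin d) => U ‖y‖) =ᶠ[nhds x]
      fun y => (U' ‖y‖ / ‖y‖) • B y := by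
    filter_upwards [isOpen_compl_singleton.mem_nhds hx] with y hy
    exact ((hU _ (norm_pos_iff.2 hy)).hasFDerivAt_comp_norm hy).fderiv
  have hW : HasDerivAt (fun r => U' r / r) ((U'' * ‖x‖ - U' ‖x‖ * 1) / ‖x‖ ^ 2) ‖x‖ :=
    hU'.div (hasDerivAt_id _) hx'
  have h2 : HasFDerivAt (fun y : EuclideanSpace ℝ (Fin d) => (U' ‖y‖ / ‖y‖) • B y)
      ((U' ‖x‖ / ‖x‖) • B + (((U'' * ‖x‖ - U' ‖x‖ * 1) / ‖x‖ ^ 2 / ‖x‖) •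
        B x).smulRight (B x)) x :=
    (hW.hasFDerivAt_comp_norm hx).smul B.hasFDerivAt
  have hsum : ∑ i, x i ^ 2 = ‖x‖ ^ 2 := (EuclideanSpace.real_norm_sq_eq x).symm
  simp only [lap, iteratedFDeriv_two_apply, hev.fderiv_eq]
  rw [h2.fderiv]
  simp only [Matrix.cons_val_zero, Matrix.cons_val_one, add_apply,
    smul_apply, ContinuousLinearMap.smulRight_apply, hB,
    EuclideanSpace.inner_single_right, PiLp.single_apply, smul_eq_mul, conj_trivial,
    Finset.sum_add_distrib, if_true, one_mul, mul_one, Finset.sum_const, Finset.card_univ,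
    Fintype.card_fin, nsmul_eq_mul, mul_assoc, ← pow_two, ← Finset.mul_sum, hsum]
  field_simp
  ring

end Radial

open besselSeries in
theorem exists_abs_le_div_one_add_pow {F : ℝ → ℝ} (hF : Continuous F) {K : ℝ}
    (hK : ∀ r, 1 ≤ r → |F r| ≤ K / besselSeries 1 r) (n : ℕ) :
    ∃ C, 0 < C ∧ ∀ r, 0 ≤ r → |F r| ≤ C / (1 + r) ^ n := by
  obtain ⟨M, hM⟩ := isCompact_Icc.exists_bound_of_continuousOn (s := Set.Icc (0 : ℝ) 1)
    hF.continuousOn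
  have hM0 : 0 ≤ M := (norm_nonneg _).trans (hM 0 (by simp))
  have hK0 : 0 ≤ K := by
    have h := (abs_nonneg _).trans (hK 1 le_rfl)
    rwa [le_div_iff₀ (pos 1 zero_le_one), zero_mul] at h
  set A : ℝ := n.factorial * (n + 1).factorial
  have hA : 0 < A := by positivity
  refine ⟨2 ^ n * (A * K + M + 1), by positivity, fun r hr => ?_⟩
  rw [le_div_iff₀ (by positivity)]
  rcases le_total r 1 with h1 | h1
  · calc |F r| * (1 + r) ^ n ≤ M * 2 ^ n := by
          gcongr
          · exact hM r ⟨hr, h1⟩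
          · linarith
      _ ≤ 2 ^ n * (A * K + M + 1) := by
          have : 0 ≤ (2 : ℝ) ^ n * (A * K + 1) := by positivity
          linarith
  · have hq := pos 1 hr
    have hterm : r ^ n ≤ besselSeries 1 r * A := (div_le_iff₀ hA).1 (term_le 1 n hr)
    calc |F r| * (1 + r) ^ n ≤ K / besselSeries 1 r * (2 * r) ^ n := by
          gcongr
          · exact hK r h1
          · linarith
      _ = K / besselSeries 1 r * 2 ^ n * r ^ n := by ring
      _ ≤ K / besselSeries 1 r * 2 ^ n * (besselSeries 1 r * A) := by gcongr
      _ = 2 ^ n * (A * K) := by field_simp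
      _ ≤ 2 ^ n * (A * K + M + 1) := by gcongr; linarith

/-- The integral of `g` against the solution `t ↦ t * besselSeries 1 t` of `φ'' = φ / t`, with
weight `t`. -/
noncomputable def radialMoment (g : ℝ → ℝ) (s : ℝ) : ℝ :=
  ∫ t in (0 : ℝ)..s, t ^ 2 * besselSeries 1 t * g t

namespace radialMoment

variable {g : ℝ → ℝ}

theorem hasDerivAt (hg : Continuous g) (s : ℝ) :
    HasDerivAt (radialMoment g) (s ^ 2 * besselSeries 1 s * g s) s :=
  (Continuous.integral_hasStrictDerivAt
    (((continuous_id.pow 2).mul (besselSeries.contDiff 1).continuous).mul hg) 0 s).hasDerivAt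

theorem contDiff (hg : ContDiff ℝ (⊤ : ℕ∞) g) : ContDiff ℝ (⊤ : ℕ∞) (radialMoment g) := by
  refine contDiff_infty_iff_deriv.2
    ⟨fun s => (hasDerivAt hg.continuous s).differentiableAt, ?_⟩
  rw [funext fun s => (hasDerivAt hg.continuous s).deriv]
  exact ((contDiff_id.pow 2).mul (besselSeries.contDiff 1)).mul hg

theorem eq_zero {δ : ℝ} (h0 : ∀ r, |r| < δ → g r = 0) {s : ℝ} (hs : |s| < δ) :
    radialMoment g s = 0 := by
  refine intervalIntegral.integral_zero_ae (.of_forall fun t ht => ?_)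
  have hts : |t| ≤ |s| := by
    simpa using Set.abs_sub_left_of_mem_uIcc (Set.uIoc_subset_uIcc ht)
  rw [h0 t (hts.trans_lt hs), mul_zero]

theorem exists_abs_le (hg : Continuous g) {R : ℝ} (hR : ∀ r, R ≤ r → g r = 0) :
    ∃ K, ∀ s, 0 ≤ s → |radialMoment g s| ≤ K := by
  have hc : Continuous (radialMoment g) :=
    continuous_iff_continuousAt.2 fun s => (hasDerivAt hg s).continuousAt
  obtain ⟨K, hK⟩ := isCompact_Icc.exists_bound_of_continuousOn (s := Set.Icc (0 : ℝ) (max R 0))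
    hc.continuousOn
  refine ⟨K, fun s hs => ?_⟩
  rcases le_total s (max R 0) with h | h
  · exact hK s ⟨hs, h⟩
  · have hinterval (a b : ℝ) : IntervalIntegrable (fun t => t ^ 2 * besselSeries 1 t * g t) volume a b :=
      (((continuous_id.pow 2).mul (besselSeries.contDiff 1).continuous).mul
        hg).intervalIntegrable a b
    have htail : ∫ t in (max R 0)..s, t ^ 2 * besselSeries 1 t * g t = 0 := by
      refine intervalIntegral.integral_zero_ae (.of_forall fun t ht => ?_)
      rw [Set.uIoc_of_le h] at ht
      rw [hR t ((le_max_left _ _).trans ht.1.le), mul_zero]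
    have heq : radialMoment g s = radialMoment g (max R 0) := by
      rw [radialMoment, radialMoment,
        ← intervalIntegral.integral_add_adjacent_intervals (hinterval 0 (max R 0)) (hinterval _ s), htail,
        add_zero]
    rw [heq]
    exact hK _ ⟨le_max_right _ _, le_rfl⟩

end radialMoment

/-- Minus the derivative of the ratio between the decaying solution of the radial equation and
the homogeneous solution `besselSeries 1`. -/
noncomputable def radialFlux (g : ℝ → ℝ) (s : ℝ) : ℝ :=
  radialMoment g s / (s * besselSeries 1 |s|) ^ 2

namespace radialFlux

variable {g : ℝ → ℝ}

theorem contDiffAt (hg : ContDiff ℝ (⊤ : ℕ∞) g) {δ : ℝ} (hδ : 0 < δ)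
    (h0 : ∀ r, |r| < δ → g r = 0) (s : ℝ) : ContDiffAt ℝ (⊤ : ℕ∞) (radialFlux g) s := by
  rcases eq_or_ne s 0 with rfl | hs
  · have hev : radialFlux g =ᶠ[nhds 0] fun _ => 0 := by
      filter_upwards [Metric.ball_mem_nhds (0 : ℝ) hδ] with t ht
      rw [mem_ball_zero_iff, Real.norm_eq_abs] at ht
      rw [radialFlux, radialMoment.eq_zero h0 ht, zero_div]
    exact contDiffAt_const.congr_of_eventuallyEq hev
  · refine (radialMoment.contDiff hg).contDiffAt.div ((contDiffAt_id.mul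
      ((besselSeries.contDiff 1).contDiffAt.comp s (contDiffAt_abs hs))).pow 2) ?_
    exact pow_ne_zero 2 (mul_ne_zero hs (besselSeries.pos 1 (abs_nonneg s)).ne')

theorem hasDerivAt (hg : Continuous g) {s : ℝ} (hs : 0 < s) :
    HasDerivAt (radialFlux g) (g s / besselSeries 1 s - 2 * radialFlux g s *
      (besselSeries 1 s + s * besselSeries 2 s) / (s * besselSeries 1 s)) s := by
  have hq := besselSeries.pos 1 hs.le
  have h := (radialMoment.hasDerivAt hg s).div
    (((hasDerivAt_id s).mul (besselSeries.hasDerivAt 1 s)).pow 2)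
    (pow_ne_zero 2 (mul_ne_zero hs.ne' hq.ne'))
  have hev : radialFlux g =ᶠ[nhds s] fun s => radialMoment g s / (s * besselSeries 1 s) ^ 2 := by
    filter_upwards [lt_mem_nhds hs] with t ht
    rw [radialFlux, abs_of_pos ht]
  refine (HasDerivAt.congr_of_eventuallyEq h hev).congr_deriv ?_
  simp only [radialFlux, abs_of_pos hs, Pi.mul_apply, id, Pi.pow_apply]
  field_simp
  ring

theorem abs_le {K : ℝ} (hK : ∀ s, 0 ≤ s → |radialMoment g s| ≤ K) {s : ℝ} (hs : 0 < s) :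
    |radialFlux g s| ≤ K / (s * besselSeries 1 s) ^ 2 := by
  have hq := besselSeries.pos 1 hs.le
  rw [radialFlux, abs_of_pos hs, abs_div, abs_of_pos (by positivity : 0 < (s * besselSeries 1 s) ^ 2)]
  gcongr
  exact hK s hs.le

end radialFlux

theorem besselSeries.hasDerivAt_neg_inv {s : ℝ} (hs : 0 < s) :
    HasDerivAt (fun s => -(s * besselSeries 1 s)⁻¹)
      (besselSeries 0 s / (s * besselSeries 1 s) ^ 2) s := by
  have hq := besselSeries.pos 1 hs.le
  have h := ((hasDerivAt_id s).mul (besselSeries.hasDerivAt 1 s)).inv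
    (mul_ne_zero hs.ne' hq.ne')
  refine h.neg.congr_deriv ?_
  have := besselSeries.recurrence 0 s
  simp only [Nat.cast_zero, zero_add, one_mul] at this
  simp only [← this, Pi.mul_apply, id]
  ring

theorem besselSeries.tendsto_neg_inv :
    Filter.Tendsto (fun s => -(s * besselSeries 1 s)⁻¹) Filter.atTop (nhds 0) := by
  rw [← neg_zero]
  refine (Filter.Tendsto.inv_tendsto_atTop ?_).neg
  refine Filter.tendsto_atTop_mono' _ ?_ Filter.tendsto_id
  filter_upwards [Filter.eventually_ge_atTop 0] with s hs
  have := besselSeries.term_le 1 0 hs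
  simp at this
  exact le_mul_of_one_le_right hs this

theorem besselSeries.integrableOn_div {r : ℝ} (hr : 0 < r) :
    IntegrableOn (fun s => besselSeries 0 s / (s * besselSeries 1 s) ^ 2) (Set.Ioi r) :=
  integrableOn_Ioi_deriv_of_nonneg' (fun _ hs => hasDerivAt_neg_inv (hr.trans_le hs))
    (fun _ hs => div_nonneg (pos 0 (hr.trans hs).le).le (sq_nonneg _)) tendsto_neg_inv

theorem besselSeries.integral_div {r : ℝ} (hr : 0 < r) :
    ∫ s in Set.Ioi r, besselSeries 0 s / (s * besselSeries 1 s) ^ 2 =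
      (r * besselSeries 1 r)⁻¹ := by
  rw [integral_Ioi_of_hasDerivAt_of_nonneg' (fun _ hs => hasDerivAt_neg_inv (hr.trans_le hs))
    (fun _ hs => div_nonneg (pos 0 (hr.trans hs).le).le (sq_nonneg _)) tendsto_neg_inv]
  ring

/-- The ratio between the decaying solution of the radial equation and `besselSeries 1`. -/
noncomputable def radialRatio (g : ℝ → ℝ) (r : ℝ) : ℝ := ∫ s in Set.Ioi r, radialFlux g s

namespace radialRatio

variable {g : ℝ → ℝ} {K : ℝ}

theorem flux_le (hK : ∀ s, 0 ≤ s → |radialMoment g s| ≤ K) {r s : ℝ} (hr : 0 < r) (hs : r < s) :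
    ‖radialFlux g s‖ ≤
      K / besselSeries 0 r * (besselSeries 0 s / (s * besselSeries 1 s) ^ 2) := by
  have hs0 : 0 < s := hr.trans hs
  have hK0 : 0 ≤ K := (abs_nonneg _).trans (hK 0 le_rfl)
  have hq := besselSeries.pos 1 hs0.le
  have hq0 := besselSeries.pos 0 hr.le
  have hmono := besselSeries.monotoneOn 0 hr.le hs0.le hs.le
  calc ‖radialFlux g s‖ ≤ K / (s * besselSeries 1 s) ^ 2 := radialFlux.abs_le hK hs0
    _ = K / besselSeries 0 r * (besselSeries 0 r / (s * besselSeries 1 s) ^ 2) := by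
        field_simp
    _ ≤ _ := by gcongr

theorem integrableOn (hc : Continuous (radialFlux g))
    (hK : ∀ s, 0 ≤ s → |radialMoment g s| ≤ K) (r : ℝ) :
    IntegrableOn (radialFlux g) (Set.Ioi r) := by
  have h1 : IntegrableOn (radialFlux g) (Set.Ioi 1) := by
    refine ((besselSeries.integrableOn_div (r := 1) one_pos).const_mul (K / besselSeries 0 1)).mono'
      hc.aestronglyMeasurable ?_
    filter_upwards [ae_restrict_mem measurableSet_Ioi] with s hs
    exact flux_le hK one_pos hs
  refine (((hc.integrableOn_Icc (a := r) (b := 1)).union h1)).mono_set fun s hs => ?_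
  rcases le_or_gt s 1 with h | h
  · exact Or.inl ⟨le_of_lt hs, h⟩
  · exact Or.inr h

theorem hasDerivAt (hc : Continuous (radialFlux g))
    (hK : ∀ s, 0 ≤ s → |radialMoment g s| ≤ K) (r : ℝ) :
    HasDerivAt (radialRatio g) (-radialFlux g r) r := by
  have heq : radialRatio g = fun r => radialRatio g 0 - ∫ s in (0 : ℝ)..r, radialFlux g s := by
    funext r
    rw [radialRatio, radialRatio, ← intervalIntegral.integral_interval_add_Ioi
      (integrableOn hc hK 0) (integrableOn hc hK r), add_sub_cancel_left]
  rw [heq]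
  exact (hc.integral_hasStrictDerivAt 0 r).hasDerivAt.const_sub _

theorem abs_le (hK : ∀ s, 0 ≤ s → |radialMoment g s| ≤ K) {r : ℝ} (hr : 0 < r) :
    |radialRatio g r| ≤ K / (besselSeries 0 r * (r * besselSeries 1 r)) := by
  refine (norm_integral_le_of_norm_le (f := radialFlux g)
    ((besselSeries.integrableOn_div hr).const_mul (K / besselSeries 0 r)) ?_).trans_eq ?_
  · filter_upwards [ae_restrict_mem measurableSet_Ioi] with s hs
    exact flux_le hK hr hs
  · rw [integral_const_mul, besselSeries.integral_div hr, ← div_eq_mul_inv, div_div]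

end radialRatio

open besselSeries in
theorem exists_radial_solution {g : ℝ → ℝ} (hg : ContDiff ℝ (⊤ : ℕ∞) g) {δ R : ℝ} (hδ : 0 < δ)
    (h0 : ∀ r, |r| < δ → g r = 0) (hR : ∀ r, R ≤ r → g r = 0) :
    ∃ U U' : ℝ → ℝ, ContDiff ℝ (⊤ : ℕ∞) U ∧ (∀ r, HasDerivAt U (U' r) r) ∧
      (∀ r, 0 < r → HasDerivAt U' (U r / r - g r - 2 * U' r / r) r) ∧
      ∀ n : ℕ, ∃ C, 0 < C ∧ ∀ r, 0 ≤ r →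
        |U r| ≤ C / (1 + r) ^ n ∧ |U' r| ≤ C / (1 + r) ^ n := by
  obtain ⟨K, hK⟩ := radialMoment.exists_abs_le hg.continuous hR
  have hK0 : 0 ≤ K := (abs_nonneg _).trans (hK 0 le_rfl)
  have hG : ContDiff ℝ (⊤ : ℕ∞) (radialFlux g) :=
    contDiff_iff_contDiffAt.2 (radialFlux.contDiffAt hg hδ h0)
  have hv := radialRatio.hasDerivAt hG.continuous hK
  have hvs : ContDiff ℝ (⊤ : ℕ∞) (radialRatio g) := by
    refine contDiff_infty_iff_deriv.2 ⟨fun r => (hv r).differentiableAt, ?_⟩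
    rw [funext fun r => (hv r).deriv]
    exact hG.neg
  set U : ℝ → ℝ := fun r => besselSeries 1 r * radialRatio g r
  set U' : ℝ → ℝ := fun r => besselSeries 2 r * radialRatio g r - besselSeries 1 r * radialFlux g r
  have hUs : ContDiff ℝ (⊤ : ℕ∞) U := (contDiff 1).mul hvs
  have hU's : Continuous U' :=
    ((contDiff 2).mul hvs).continuous.sub ((contDiff 1).mul hG).continuous
  refine ⟨U, U', hUs, fun r => ?_, fun r hr => ?_, fun n => ?_⟩
  · refine ((hasDerivAt 1 r).mul (hv r)).congr_deriv ?_
    simp only [U']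
    ring
  · refine (((hasDerivAt 2 r).mul (hv r)).sub ((hasDerivAt 1 r).mul
      (radialFlux.hasDerivAt hg.continuous hr))).congr_deriv ?_
    have hq := pos 1 hr.le
    have hrec := recurrence 1 r
    norm_num at hrec ⊢
    simp only [U, U']
    field_simp
    rw [← hrec]
    ring
  · have hbound (r : ℝ) (hr : 1 ≤ r) :
        |besselSeries 1 r * radialRatio g r| ≤ K / besselSeries 1 r ∧
        |besselSeries 2 r * radialRatio g r| ≤ K / besselSeries 1 r ∧
        |besselSeries 1 r * radialFlux g r| ≤ K / besselSeries 1 r := by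
      have hr0 : 0 < r := one_pos.trans_le hr
      have hq0 := pos 0 hr0.le
      have hq1 := pos 1 hr0.le
      have hq2 := pos 2 hr0.le
      have h1 : |besselSeries 1 r * radialRatio g r| ≤ K / besselSeries 1 r := by
        rw [abs_mul, abs_of_pos hq1]
        calc besselSeries 1 r * |radialRatio g r|
            ≤ besselSeries 1 r * (K / (besselSeries 0 r * (r * besselSeries 1 r))) := by
              gcongr
              exact radialRatio.abs_le hK hr0
          _ = K / (besselSeries 0 r * r) := by field_simp
          _ ≤ K / (besselSeries 1 r * 1) := by
              gcongr
              exact succ_le 0 hr0.le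
          _ = K / besselSeries 1 r := by rw [mul_one]
      refine ⟨h1, le_trans ?_ h1, ?_⟩
      · rw [abs_mul, abs_mul, abs_of_pos hq1, abs_of_pos hq2]
        gcongr
        exact succ_le 1 hr0.le
      · rw [abs_mul, abs_of_pos hq1]
        calc besselSeries 1 r * |radialFlux g r|
            ≤ besselSeries 1 r * (K / (r * besselSeries 1 r) ^ 2) := by
              gcongr
              exact radialFlux.abs_le hK hr0
          _ = K / (r ^ 2 * besselSeries 1 r) := by field_simp
          _ ≤ K / (1 * besselSeries 1 r) := by
              gcongr
              exact one_le_pow₀ hr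
          _ = K / besselSeries 1 r := by rw [one_mul]
    obtain ⟨C₁, hC₁, h₁⟩ := exists_abs_le_div_one_add_pow hUs.continuous
      (fun r hr => (hbound r hr).1) n
    obtain ⟨C₂, hC₂, h₂⟩ := exists_abs_le_div_one_add_pow (K := K + K) hU's
      (fun r hr => by
        rw [add_div]
        exact (abs_sub _ _).trans (add_le_add (hbound r hr).2.1 (hbound r hr).2.2)) n
    refine ⟨max C₁ C₂, lt_max_of_lt_left hC₁, fun r hr => ⟨(h₁ r hr).trans ?_,
      (h₂ r hr).trans ?_⟩⟩
    · gcongr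
      exact le_max_left _ _
    · gcongr
      exact le_max_right _ _

theorem integrable_sq_add_norm_gradient_sq {u : EuclideanSpace ℝ (Fin 3) → ℝ}
    (hu : Continuous u) {C : ℝ}
    (hC : ∀ x, x ≠ 0 → |u x| ≤ C / (1 + ‖x‖) ^ 2 ∧ ‖fderiv ℝ u x‖ ≤ C / (1 + ‖x‖) ^ 2) :
    Integrable fun x => u x ^ 2 + ‖gradient u x‖ ^ 2 := by
  have hgrad (x : EuclideanSpace ℝ (Fin 3)) : ‖gradient u x‖ = ‖fderiv ℝ u x‖ := by
    simp [gradient]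
  simp only [hgrad]
  have hdom : Integrable fun x : EuclideanSpace ℝ (Fin 3) =>
      2 * C ^ 2 * (1 + ‖x‖) ^ (-4 : ℝ) :=
    (integrable_one_add_norm (by simp; norm_num)).const_mul _
  refine hdom.mono' ((hu.measurable.pow_const 2).add
    ((measurable_fderiv ℝ u).norm.pow_const 2)).aestronglyMeasurable ?_
  filter_upwards [compl_mem_ae_iff.2 (measure_singleton (0 : EuclideanSpace ℝ (Fin 3)))] with x hx
  obtain ⟨h1, h2⟩ := hC x hx
  have h1' := pow_le_pow_left₀ (abs_nonneg _) h1 2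
  have h2' := pow_le_pow_left₀ (norm_nonneg _) h2 2
  have hpos : 0 < 1 + ‖x‖ := by positivity
  have hpow : (1 + ‖x‖) ^ (-4 : ℝ) = ((1 + ‖x‖) ^ 4)⁻¹ := by
    rw [Real.rpow_neg hpos.le]
    norm_cast
  rw [Real.norm_of_nonneg (by positivity), hpow]
  rw [sq_abs] at h1'
  have hsq : (C / (1 + ‖x‖) ^ 2) ^ 2 = C ^ 2 * ((1 + ‖x‖) ^ 4)⁻¹ := by
    rw [div_pow, ← pow_mul, div_eq_mul_inv]
  linarith

/-- For radial smooth `f` compactly supported in `ℝ³∖{0}`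
there is a radial solution `u` of `-Δu + u/|x| = f` (away from the origin)
that is continuous on `ℝ³`, smooth away from `0`, belongs to `H¹(ℝ³)`, and
decays faster than any polynomial at infinity. -/
theorem stmt11 (f : EuclideanSpace ℝ (Fin 3) → ℝ)
    (hrad : ∀ x y : EuclideanSpace ℝ (Fin 3), ‖x‖ = ‖y‖ → f x = f y)
    (hsmooth : ContDiff ℝ (⊤ : ℕ∞) f) (hcompact : HasCompactSupport f)
    (hsupp : (0 : EuclideanSpace ℝ (Fin 3)) ∉ tsupport f) :
    ∃ u : EuclideanSpace ℝ (Fin 3) → ℝ,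
      (∀ x y : EuclideanSpace ℝ (Fin 3), ‖x‖ = ‖y‖ → u x = u y) ∧
      Continuous u ∧
      ContDiffOn ℝ (⊤ : ℕ∞) u {(0 : EuclideanSpace ℝ (Fin 3))}ᶜ ∧
      (∀ x : EuclideanSpace ℝ (Fin 3), x ≠ 0 → -lap u x + u x / ‖x‖ = f x) ∧
      Integrable (fun x : EuclideanSpace ℝ (Fin 3) =>
        (u x) ^ 2 + ‖gradient u x‖ ^ 2) ∧
      (∀ N : ℝ, 0 < N → ∃ C : ℝ, 0 < C ∧
        ∀ x : EuclideanSpace ℝ (Fin 3), 1 ≤ ‖x‖ → |u x| ≤ C * ‖x‖ ^ (-N)) := by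
  set e : EuclideanSpace ℝ (Fin 3) := EuclideanSpace.single 0 1
  have he : ‖e‖ = 1 := by simp [e]
  set g : ℝ → ℝ := fun r => f (r • e)
  have hfg (x : EuclideanSpace ℝ (Fin 3)) : f x = g ‖x‖ :=
    hrad _ _ (by rw [norm_smul, he, norm_norm, mul_one])
  have hg : ContDiff ℝ (⊤ : ℕ∞) g := hsmooth.comp (contDiff_id.smul contDiff_const)
  obtain ⟨δ, hδ, hδf⟩ := Metric.eventually_nhds_iff.1 (notMem_tsupport_iff_eventuallyEq.1 hsupp)
  obtain ⟨R, hRf⟩ := hcompact.isBounded.subset_ball 0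
  obtain ⟨U, U', hUs, hU, hU', hdecay⟩ := exists_radial_solution (R := max R 0) hg hδ
    (fun r hr => hδf (by simpa [norm_smul, he] using hr))
    (fun r hr => by
      refine image_eq_zero_of_notMem_tsupport (f := f) (x := r • e) fun hmem => ?_
      have h := hRf hmem
      rw [mem_ball_zero_iff, norm_smul, he, mul_one, Real.norm_eq_abs] at h
      linarith [le_abs_self r, le_max_left R 0])
  have hu : Continuous fun x : EuclideanSpace ℝ (Fin 3) => U ‖x‖ :=
    hUs.continuous.comp continuous_norm
  refine ⟨fun x => U ‖x‖, fun x y h => congrArg U h, hu, fun x hx => ?_, fun x hx => ?_, ?_,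
    fun N _ => ?_⟩
  · exact (hUs.contDiffAt.comp x (contDiffAt_norm ℝ hx)).contDiffWithinAt
  · rw [lap_comp_norm hx (fun r _ => hU r) (hU' _ (norm_pos_iff.2 hx)), hfg]
    push_cast
    ring
  · obtain ⟨C, -, hC⟩ := hdecay 2
    refine integrable_sq_add_norm_gradient_sq hu (C := C) fun x hx => ?_
    rw [norm_fderiv_comp_norm hx (hU _)]
    exact hC _ (norm_nonneg x)
  · obtain ⟨n, hn⟩ := exists_nat_ge N
    obtain ⟨C, hC0, hC⟩ := hdecay n
    refine ⟨C, hC0, fun x hx => (hC _ (norm_nonneg x)).1.trans ?_⟩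
    rw [Real.rpow_neg (norm_nonneg x), ← div_eq_mul_inv]
    gcongr
    calc ‖x‖ ^ N ≤ ‖x‖ ^ (n : ℝ) := Real.rpow_le_rpow_of_exponent_le hx hn
      _ = ‖x‖ ^ n := Real.rpow_natCast _ _
      _ ≤ (1 + ‖x‖) ^ n := by gcongr; linarith
end
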